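/- arXiv:1901.05380 — 5 statements merged into one kernel-verified Lean document; each statement's English description precedes it below -/
import Mathlib

section
/- Let 1 < α ≤ 2, τ > 0 and r > 0. For 0 < c < 1 define K_c(x) := c^{−α} ∫_ℝ |f_{cτ}(x,s)|^α ds for x > 0. Then lim_{c→0} ∫_0^∞ (exp(−r (log(1/c))^{−1} K_c(x)) − 1) dx = −r τ^α/α. In particular, the auxiliary function K̃(w) := (1/α)((1−e^{−wτ})/w)^α + w ∫_0^τ ((1−e^{−ws})/w)^α ds satisfies lim_{w→0} K̃(w) = τ^α/α. -/
open MeasureTheory Filter Set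

/-- `f_τ(x,s) := ∫_0^τ e^{−x(t−s)} 1(s ≤ t) dt`. -/
noncomputable def fker (τ x s : ℝ) : ℝ :=
  ∫ t in Set.Ioc (0:ℝ) τ, if s ≤ t then Real.exp (-x * (t - s)) else 0

/-- The kernel `∫_0^s e^{-w u} du = (1 - e^{-w s}) / w`. -/
noncomputable def expKernel (w s : ℝ) : ℝ := (1 - Real.exp (-w * s)) / w

/-- The auxiliary function `K̃`. -/
noncomputable def auxK (α τ w : ℝ) : ℝ :=
  (1 / α) * expKernel w τ ^ α + w * ∫ s in Set.Ioc (0:ℝ) τ, expKernel w s ^ α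

lemma div_one_add_le_one_sub_exp_neg {y : ℝ} (hy : 0 ≤ y) :
    y / (1 + y) ≤ 1 - Real.exp (-y) := by
  have h1 : (1 + y) * Real.exp (-y) ≤ 1 := by
    have h2 := Real.add_one_le_exp y
    calc (1 + y) * Real.exp (-y) ≤ Real.exp y * Real.exp (-y) := by gcongr; linarith
      _ = 1 := by rw [← Real.exp_add]; simp
  rw [div_le_iff₀ (by positivity)]
  nlinarith

lemma expKernel_nonneg {w s : ℝ} (hw : 0 < w) (hs : 0 ≤ s) : 0 ≤ expKernel w s := by
  have : Real.exp (-w * s) ≤ 1 := Real.exp_le_one_iff.2 (by nlinarith)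
  exact div_nonneg (by linarith) hw.le

lemma expKernel_le_self {w s : ℝ} (hw : 0 < w) : expKernel w s ≤ s := by
  rw [expKernel, div_le_iff₀ hw]
  have := Real.add_one_le_exp (-w * s)
  linarith

lemma expKernel_le_inv {w s : ℝ} (hw : 0 < w) : expKernel w s ≤ w⁻¹ := by
  rw [expKernel, div_le_iff₀ hw, inv_mul_cancel₀ hw.ne']
  linarith [Real.exp_pos (-w * s)]

lemma div_one_add_mul_le_expKernel {w s : ℝ} (hw : 0 < w) (hs : 0 ≤ s) :
    s / (1 + w * s) ≤ expKernel w s := by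
  have h := div_one_add_le_one_sub_exp_neg (mul_nonneg hw.le hs)
  rw [expKernel, le_div_iff₀ hw, neg_mul]
  calc s / (1 + w * s) * w = w * s / (1 + w * s) := by ring
    _ ≤ _ := h

lemma continuous_expKernel (w : ℝ) : Continuous (expKernel w) := by
  unfold expKernel; fun_prop

lemma continuous_expKernel_rpow (w : ℝ) {α : ℝ} (hα : 0 ≤ α) :
    Continuous fun s => expKernel w s ^ α :=
  (continuous_expKernel w).rpow_const fun _ => Or.inr hα

lemma tendsto_expKernel_nhdsGT_zero {τ : ℝ} (hτ : 0 ≤ τ) :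
    Tendsto (fun w => expKernel w τ) (nhdsWithin 0 (Ioi 0)) (nhds τ) := by
  have h : Tendsto (fun w : ℝ => τ / (1 + w * τ)) (nhdsWithin 0 (Ioi 0)) (nhds τ) := by
    have : ContinuousAt (fun w : ℝ => τ / (1 + w * τ)) 0 :=
      ContinuousAt.div (by fun_prop) (by fun_prop) (by simp)
    simpa using this.tendsto.mono_left nhdsWithin_le_nhds
  refine tendsto_of_tendsto_of_tendsto_of_le_of_le' h tendsto_const_nhds ?_ ?_
  · filter_upwards [self_mem_nhdsWithin] with w hw using div_one_add_mul_le_expKernel hw hτ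
  · filter_upwards [self_mem_nhdsWithin] with w hw using expKernel_le_self hw

lemma setIntegral_expKernel_rpow_le {α τ w B : ℝ} (hα : 0 ≤ α) (hτ : 0 ≤ τ) (hw : 0 < w)
    (hB : ∀ s ∈ Ioc 0 τ, expKernel w s ≤ B) :
    ∫ s in Ioc 0 τ, expKernel w s ^ α ≤ τ * B ^ α := by
  calc ∫ s in Ioc 0 τ, expKernel w s ^ α ≤ ∫ _ in Ioc 0 τ, B ^ α := by
        refine setIntegral_mono_on ?_ (by simp) measurableSet_Ioc fun s hs =>
          Real.rpow_le_rpow (expKernel_nonneg hw hs.1.le) (hB s hs) hα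
        exact (continuous_expKernel_rpow w hα).integrableOn_Ioc
    _ = τ * B ^ α := by simp [hτ]

lemma setIntegral_expKernel_rpow_nonneg {α τ w : ℝ} (hw : 0 < w) :
    0 ≤ ∫ s in Ioc 0 τ, expKernel w s ^ α :=
  setIntegral_nonneg measurableSet_Ioc fun _ hs =>
    Real.rpow_nonneg (expKernel_nonneg hw hs.1.le) _

lemma auxK_nonneg {α τ w : ℝ} (hα : 0 < α) (hτ : 0 ≤ τ) (hw : 0 < w) : 0 ≤ auxK α τ w :=
  add_nonneg (mul_nonneg (by positivity) (Real.rpow_nonneg (expKernel_nonneg hw hτ) _))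
    (mul_nonneg hw.le (setIntegral_expKernel_rpow_nonneg hw))

lemma auxK_le_of_expKernel_le {α τ w B : ℝ} (hα : 0 < α) (hτ : 0 ≤ τ) (hw : 0 < w)
    (hB : ∀ s ∈ Icc 0 τ, expKernel w s ≤ B) :
    auxK α τ w ≤ (1 / α + w * τ) * B ^ α := by
  have h1 := Real.rpow_le_rpow (expKernel_nonneg hw hτ) (hB τ ⟨hτ, le_rfl⟩) hα.le
  have h2 := setIntegral_expKernel_rpow_le hα.le hτ hw fun s hs => hB s ⟨hs.1.le, hs.2⟩
  calc auxK α τ w ≤ 1 / α * B ^ α + w * (τ * B ^ α) := by unfold auxK; gcongr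
    _ = _ := by ring

lemma tendsto_auxK_nhdsGT_zero {α τ : ℝ} (hα : 0 < α) (hτ : 0 ≤ τ) :
    Tendsto (auxK α τ) (nhdsWithin 0 (Ioi 0)) (nhds (τ ^ α / α)) := by
  have h1 : Tendsto (fun w => (1 / α) * expKernel w τ ^ α) (nhdsWithin 0 (Ioi 0))
      (nhds ((1 / α) * τ ^ α)) :=
    ((tendsto_expKernel_nhdsGT_zero hτ).rpow_const (Or.inr hα.le)).const_mul _
  have h2 : Tendsto (fun w => w * ∫ s in Ioc 0 τ, expKernel w s ^ α) (nhdsWithin 0 (Ioi 0))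
      (nhds 0) := by
    have h3 : Tendsto (fun w : ℝ => w * (τ * τ ^ α)) (nhdsWithin 0 (Ioi 0)) (nhds 0) := by
      have : Continuous fun w : ℝ => w * (τ * τ ^ α) := by fun_prop
      simpa using (this.tendsto 0).mono_left nhdsWithin_le_nhds
    refine tendsto_of_tendsto_of_tendsto_of_le_of_le' tendsto_const_nhds h3 ?_ ?_
    · filter_upwards [self_mem_nhdsWithin] with w hw using
        mul_nonneg (le_of_lt hw) (setIntegral_expKernel_rpow_nonneg hw)
    · filter_upwards [self_mem_nhdsWithin] with w hw using
        mul_le_mul_of_nonneg_left (setIntegral_expKernel_rpow_le hα.le hτ hw fun s hs =>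
          (expKernel_le_self hw).trans hs.2) (le_of_lt hw)
  have h := h1.add h2
  rw [add_zero, one_div_mul_eq_div] at h
  exact h

lemma exists_auxK_le {α τ : ℝ} (hα : 1 < α) (hτ : 0 ≤ τ) :
    ∃ C, 0 ≤ C ∧ ∀ w, 0 < w → auxK α τ w ≤ C ∧ auxK α τ w ≤ C * w ^ (1 - α) := by
  have hα0 : 0 < α := by linarith
  have hτα := Real.rpow_nonneg hτ α
  have small : ∀ w, 0 < w → w ≤ 1 → auxK α τ w ≤ (1 / α + τ) * (τ ^ α + 1) := fun w hw hw1 =>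
    calc auxK α τ w ≤ (1 / α + w * τ) * τ ^ α :=
          auxK_le_of_expKernel_le hα0 hτ hw fun s hs => (expKernel_le_self hw).trans hs.2
      _ ≤ (1 / α + 1 * τ) * (τ ^ α + 1) := by gcongr; linarith
      _ = _ := by ring
  have large : ∀ w, 1 ≤ w → auxK α τ w ≤ (1 / α + τ) * (τ ^ α + 1) * w ^ (1 - α) := by
    intro w hw1
    have hw : 0 < w := by linarith
    have hp : w ^ (1 - α) = w * w⁻¹ ^ α := by
      rw [Real.rpow_sub hw, Real.rpow_one, Real.inv_rpow hw.le, div_eq_mul_inv]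
    calc auxK α τ w ≤ (1 / α + w * τ) * w⁻¹ ^ α :=
          auxK_le_of_expKernel_le hα0 hτ hw fun s _ => expKernel_le_inv hw
      _ ≤ (w * (1 / α) + w * τ) * w⁻¹ ^ α := by
          gcongr
          exact le_mul_of_one_le_left (by positivity) hw1
      _ = (1 / α + τ) * 1 * w ^ (1 - α) := by rw [hp]; ring
      _ ≤ (1 / α + τ) * (τ ^ α + 1) * w ^ (1 - α) := by gcongr; linarith
  have hC : 0 ≤ (1 / α + τ) * (τ ^ α + 1) := by positivity
  refine ⟨_, hC, fun w hw => ?_⟩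
  rcases le_total w 1 with hw1 | hw1
  · refine ⟨small w hw hw1, (small w hw hw1).trans (le_mul_of_one_le_right hC ?_)⟩
    exact Real.one_le_rpow_of_pos_of_le_one_of_nonpos hw hw1 (by linarith)
  · refine ⟨(large w hw1).trans (mul_le_of_le_one_right hC ?_), large w hw1⟩
    exact Real.rpow_le_one_of_one_le_of_nonpos hw1 (by linarith)

lemma measurable_auxK (α τ : ℝ) : Measurable (auxK α τ) := by
  have h : Measurable (Function.uncurry expKernel) := by
    unfold expKernel Function.uncurry; fun_prop
  have h1 : Measurable fun w => ∫ s in Ioc (0:ℝ) τ, expKernel w s ^ α :=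
    (StronglyMeasurable.integral_prod_right' (f := fun p : ℝ × ℝ => expKernel p.1 p.2 ^ α)
      (Measurable.pow_const h α).stronglyMeasurable).measurable
  have h2 : Measurable fun w => expKernel w τ := by unfold expKernel; fun_prop
  exact ((h2.pow_const α).const_mul _).add (measurable_id.mul h1)

lemma fker_eq_setIntegral (T x s : ℝ) :
    fker T x s = ∫ t in Ioc 0 T ∩ Ici s, Real.exp (-x * (t - s)) := by
  rw [← setIntegral_indicator measurableSet_Ici]
  rfl

lemma integral_exp_neg_mul_sub {x : ℝ} (hx : x ≠ 0) (a b s : ℝ) :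
    ∫ t in a..b, Real.exp (-x * (t - s))
      = (Real.exp (-x * (a - s)) - Real.exp (-x * (b - s))) / x := by
  have h : ∀ t ∈ uIcc a b, HasDerivAt (fun t => -Real.exp (-x * (t - s)) / x)
      (Real.exp (-x * (t - s))) t := fun t _ => by
    have h1 : HasDerivAt (fun t => -x * (t - s)) (-x * 1) t :=
      ((hasDerivAt_id t).sub_const s).const_mul (-x)
    exact (h1.exp.neg.div_const x).congr_deriv (by
      rw [mul_one, mul_neg, neg_neg, mul_div_cancel_right₀ _ hx])
  rw [intervalIntegral.integral_eq_sub_of_hasDerivAt h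
    ((by fun_prop : Continuous _).intervalIntegrable _ _)]
  ring

lemma fker_of_nonpos {T x s : ℝ} (hT : 0 ≤ T) (hx : x ≠ 0) (hs : s ≤ 0) :
    fker T x s = Real.exp (x * s) * expKernel x T := by
  have : Ioc 0 T ∩ Ici s = Ioc 0 T := inter_eq_left.2 fun t ht => hs.trans ht.1.le
  rw [fker_eq_setIntegral, this, ← intervalIntegral.integral_of_le hT,
    integral_exp_neg_mul_sub hx, expKernel, mul_div_assoc', mul_one_sub,
    ← Real.exp_add]
  ring_nf

lemma fker_of_mem_Ioc {T x s : ℝ} (hx : x ≠ 0) (hs : s ∈ Ioc 0 T) :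
    fker T x s = expKernel x (T - s) := by
  have : Ioc 0 T ∩ Ici s = Icc s T := by
    ext t
    exact ⟨fun h => ⟨h.2, h.1.2⟩, fun h => ⟨⟨hs.1.trans_le h.1, h.2⟩, h.1⟩⟩
  rw [fker_eq_setIntegral, this, integral_Icc_eq_integral_Ioc,
    ← intervalIntegral.integral_of_le hs.2, integral_exp_neg_mul_sub hx, expKernel]
  simp

lemma fker_of_lt {T x s : ℝ} (hs : T < s) : fker T x s = 0 := by
  have : Ioc 0 T ∩ Ici s = ∅ := by
    ext t
    simp only [mem_inter_iff, mem_Ioc, mem_Ici, mem_empty_iff_false, iff_false]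
    intro h
    linarith [h.1.2, h.2]
  rw [fker_eq_setIntegral, this]
  simp

lemma integral_abs_fker_rpow {α T x : ℝ} (hα : 0 < α) (hT : 0 ≤ T) (hx : 0 < x) :
    ∫ s, |fker T x s| ^ α
      = expKernel x T ^ α / (α * x) + ∫ s in Ioc 0 T, expKernel x s ^ α := by
  have hneg : EqOn (fun s => |fker T x s| ^ α)
      (fun s => Real.exp ((α * x) * s) * expKernel x T ^ α) (Iic 0) := by
    intro s hs
    have h0 := expKernel_nonneg hx hT
    simp only
    rw [fker_of_nonpos hT hx.ne' hs, abs_of_nonneg (by positivity),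
      Real.mul_rpow (Real.exp_pos _).le h0, ← Real.exp_mul]
    ring_nf
  have hpos : EqOn (fun s => |fker T x s| ^ α)
      ((Ioc 0 T).indicator fun s => expKernel x (T - s) ^ α) (Ioi 0) := by
    intro s hs
    by_cases hsT : s ≤ T
    · simp only
      rw [indicator_of_mem (mem_Ioc.2 ⟨hs, hsT⟩), fker_of_mem_Ioc hx.ne' ⟨hs, hsT⟩,
        abs_of_nonneg (expKernel_nonneg hx (by linarith))]
    · simp only
      rw [indicator_of_notMem (fun h => hsT h.2), fker_of_lt (not_le.1 hsT), abs_zero,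
        Real.zero_rpow hα.ne']
  have hcont : Continuous fun s => expKernel x (T - s) ^ α :=
    (continuous_expKernel_rpow x hα.le).comp (continuous_const.sub continuous_id)
  have ineg : IntegrableOn (fun s => |fker T x s| ^ α) (Iic 0) := by
    rw [integrableOn_congr_fun hneg measurableSet_Iic]
    exact (integrableOn_exp_mul_Iic (by positivity) 0).mul_const _
  have ipos : IntegrableOn (fun s => |fker T x s| ^ α) (Ioi 0) := by
    rw [integrableOn_congr_fun hpos measurableSet_Ioi]
    exact (hcont.integrableOn_Ioc.integrable_indicator measurableSet_Ioc).integrableOn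
  have hsub : Ioi 0 ∩ Ioc 0 T = Ioc 0 T := inter_eq_right.2 fun _ h => h.1
  rw [← intervalIntegral.integral_Iic_add_Ioi ineg ipos,
    setIntegral_congr_fun measurableSet_Iic hneg, setIntegral_congr_fun measurableSet_Ioi hpos,
    integral_mul_const, integral_exp_mul_Iic (by positivity),
    setIntegral_indicator measurableSet_Ioc, hsub, ← intervalIntegral.integral_of_le hT,
    intervalIntegral.integral_comp_sub_left (fun s => expKernel x s ^ α), sub_self, sub_zero,
    intervalIntegral.integral_of_le hT, mul_zero, Real.exp_zero]
  ring

lemma expKernel_mul {c x : ℝ} (hc : c ≠ 0) (s : ℝ) :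
    expKernel x (c * s) = c * expKernel (c * x) s := by
  have : -x * (c * s) = -(c * x) * s := by ring
  rw [expKernel, expKernel, this, mul_div_assoc', mul_div_mul_left _ _ hc]

lemma rpow_neg_mul_integral_abs_fker_rpow {α τ c x : ℝ} (hα : 0 < α) (hτ : 0 ≤ τ) (hc : 0 < c)
    (hx : 0 < x) :
    c ^ (-α) * ∫ s, |fker (c * τ) x s| ^ α = auxK α τ (c * x) / x := by
  have hcx : 0 < c * x := by positivity
  have hscale : ∀ s, 0 ≤ s → expKernel x (c * s) ^ α = c ^ α * expKernel (c * x) s ^ α :=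
    fun s hs => by rw [expKernel_mul hc.ne', Real.mul_rpow hc.le (expKernel_nonneg hcx hs)]
  have hint : ∫ s in Ioc 0 (c * τ), expKernel x s ^ α
      = c * (c ^ α * ∫ s in Ioc 0 τ, expKernel (c * x) s ^ α) := by
    have h := intervalIntegral.integral_comp_mul_left (a := 0) (b := τ)
      (fun s => expKernel x s ^ α) hc.ne'
    rw [mul_zero, intervalIntegral.integral_of_le hτ,
      intervalIntegral.integral_of_le (by positivity),
      setIntegral_congr_fun measurableSet_Ioc (fun s hs => hscale s hs.1.le),
      integral_const_mul, smul_eq_mul] at h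
    rw [h, mul_inv_cancel_left₀ hc.ne']
  have hcα : c ^ (-α) * c ^ α = 1 := by rw [← Real.rpow_add hc]; simp
  rw [integral_abs_fker_rpow hα (by positivity) hx, hint, hscale τ hτ, auxK]
  calc _ = (c ^ (-α) * c ^ α) * (expKernel (c * x) τ ^ α / (α * x)
        + c * ∫ s in Ioc 0 τ, expKernel (c * x) s ^ α) := by ring
    _ = _ := by rw [hcα]; field_simp

/-- The integrand of the exponent after the substitution `x = e^{L v}`, with `L = log (1 / c)`. -/
noncomputable def logIntegrand (α τ r L v : ℝ) : ℝ :=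
  L * Real.exp (L * v) *
    (Real.exp (-r * L⁻¹ * (auxK α τ (Real.exp (L * (v - 1))) / Real.exp (L * v))) - 1)

lemma integral_Ioi_eq_integral_comp_exp {L : ℝ} (hL : 0 < L) (g : ℝ → ℝ) :
    ∫ x in Ioi (0:ℝ), g x = ∫ v, L * Real.exp (L * v) * g (Real.exp (L * v)) := by
  have himg : (fun v => Real.exp (L * v)) '' univ = Ioi 0 := by
    ext x
    refine ⟨?_, fun hx => ⟨Real.log x / L, mem_univ _, ?_⟩⟩
    · rintro ⟨v, -, rfl⟩
      exact Real.exp_pos _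
    · simp only
      rw [mul_div_cancel₀ _ hL.ne', Real.exp_log hx]
  have hd : ∀ v ∈ univ, HasDerivWithinAt (fun v => Real.exp (L * v)) (L * Real.exp (L * v))
      univ v := fun v _ => by
    have h : HasDerivAt (fun v => L * v) (L * 1) v := (hasDerivAt_id v).const_mul L
    exact (h.exp.congr_deriv (by rw [mul_one, mul_comm])).hasDerivWithinAt
  have hinj : InjOn (fun v => Real.exp (L * v)) univ := fun a _ b _ h =>
    mul_left_cancel₀ hL.ne' (Real.exp_injective h)
  rw [← himg, integral_image_eq_integral_abs_deriv_smul MeasurableSet.univ hd hinj,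
    setIntegral_univ]
  refine integral_congr_ae (Eventually.of_forall fun v => ?_)
  simp only [smul_eq_mul]
  rw [abs_of_pos (by positivity)]

lemma integral_exponent_eq {α τ r c : ℝ} (hα : 0 < α) (hτ : 0 ≤ τ) (hc : c ∈ Ioo 0 1) :
    ∫ x in Set.Ioi (0:ℝ), (Real.exp (-r * (Real.log (1 / c))⁻¹
        * (c ^ (-α) * ∫ s : ℝ, |fker (c * τ) x s| ^ α)) - 1)
      = ∫ v, logIntegrand α τ r (Real.log (1 / c)) v := by
  have hL : 0 < Real.log (1 / c) := Real.log_pos (by rw [lt_div_iff₀ hc.1]; linarith [hc.2])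
  rw [integral_Ioi_eq_integral_comp_exp hL]
  refine integral_congr_ae (Eventually.of_forall fun v => ?_)
  simp only [logIntegrand]
  have hcexp : Real.exp (Real.log (1 / c) * (v - 1)) = c * Real.exp (Real.log (1 / c) * v) := by
    rw [mul_sub, mul_one, Real.exp_sub, Real.exp_log (by have := hc.1; positivity)]
    field_simp
  rw [rpow_neg_mul_integral_abs_fker_rpow hα hτ hc.1 (Real.exp_pos _), hcexp]

lemma measurable_logIntegrand (α τ r L : ℝ) : Measurable (logIntegrand α τ r L) := by
  have h : Measurable fun v => auxK α τ (Real.exp (L * (v - 1))) :=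
    (measurable_auxK α τ).comp (by fun_prop)
  unfold logIntegrand
  fun_prop

lemma logIntegrand_nonpos_and_le {α τ r L : ℝ} (hα : 0 < α) (hτ : 0 ≤ τ) (hr : 0 ≤ r) (hL : 0 < L)
    (v : ℝ) :
    logIntegrand α τ r L v ≤ 0 ∧ -logIntegrand α τ r L v ≤ L * Real.exp (L * v) ∧
      -logIntegrand α τ r L v ≤ r * auxK α τ (Real.exp (L * (v - 1))) ∧
      r * auxK α τ (Real.exp (L * (v - 1))) /
        (1 + r * L⁻¹ * (auxK α τ (Real.exp (L * (v - 1))) / Real.exp (L * v)))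
        ≤ -logIntegrand α τ r L v := by
  have hK := auxK_nonneg hα hτ (Real.exp_pos (L * (v - 1)))
  unfold logIntegrand
  set K := auxK α τ (Real.exp (L * (v - 1)))
  have hX := Real.exp_pos (L * v)
  set X := Real.exp (L * v)
  have hy : 0 ≤ r * L⁻¹ * (K / X) := by positivity
  have hLXy : L * X * (r * L⁻¹ * (K / X)) = r * K := by field_simp
  have e : -r * L⁻¹ * (K / X) = -(r * L⁻¹ * (K / X)) := by ring
  rw [e]
  set y := r * L⁻¹ * (K / X)
  have hLX : 0 < L * X := by positivity
  have h1 : Real.exp (-y) ≤ 1 := Real.exp_le_one_iff.2 (by linarith)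
  have h2 := Real.exp_pos (-y)
  have h3 := Real.add_one_le_exp (-y)
  have h4 := mul_le_mul_of_nonneg_left (div_one_add_le_one_sub_exp_neg hy) hLX.le
  refine ⟨by nlinarith, by nlinarith, by nlinarith, ?_⟩
  rw [mul_div_assoc', hLXy] at h4
  linarith

lemma integrable_exp_neg_mul_abs {δ : ℝ} (hδ : 0 < δ) :
    Integrable fun v : ℝ => Real.exp (-δ * |v|) := by
  rw [← integrableOn_univ, ← Iic_union_Ioi (a := (0:ℝ))]
  refine IntegrableOn.union ?_ ?_
  · refine (integrableOn_congr_fun (fun v hv => ?_) measurableSet_Iic).1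
      (integrableOn_exp_mul_Iic hδ 0)
    rw [abs_of_nonpos hv, neg_mul_neg]
  · refine (integrableOn_congr_fun (fun v hv => ?_) measurableSet_Ioi).1
      (integrableOn_exp_mul_Ioi (neg_lt_zero.2 hδ) 0)
    rw [abs_of_pos hv]

lemma exp_mul_rpow_eq (L v p : ℝ) : Real.exp (L * v) ^ p = Real.exp (p * (L * v)) := by
  rw [← Real.exp_mul, mul_comm]

lemma exists_abs_logIntegrand_le {α τ r : ℝ} (hα : 1 < α) (hτ : 0 ≤ τ) (hr : 0 ≤ r) :
    ∃ B δ, 0 < δ ∧ ∀ L, 1 ≤ L → ∀ v, ‖logIntegrand α τ r L v‖ ≤ B * Real.exp (-δ * |v|) := by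
  obtain ⟨C, hC, hK⟩ := exists_auxK_le hα hτ
  set δ := min (1 / 2) (α - 1) with hδ_def
  have hδ : 0 < δ := lt_min (by norm_num) (by linarith)
  have hδ1 : δ ≤ 1 / 2 := min_le_left _ _
  have hδ2 : δ ≤ α - 1 := min_le_right _ _
  refine ⟨(2 + r * C) * Real.exp δ, δ, hδ, fun L hL v => ?_⟩
  obtain ⟨h0, h1, h2, -⟩ :=
    logIntegrand_nonpos_and_le (r := r) (by linarith : 0 < α) hτ hr (by linarith : 0 < L) v
  obtain ⟨hK1, hK2⟩ := hK _ (Real.exp_pos (L * (v - 1)))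
  have hrC : 0 ≤ r * C := by positivity
  rw [Real.norm_of_nonpos h0, mul_assoc, ← Real.exp_add]
  rcases le_total 1 v with hv | hv
  · rw [exp_mul_rpow_eq] at hK2
    rw [abs_of_nonneg (by linarith)]
    calc _ ≤ r * (C * Real.exp ((1 - α) * (L * (v - 1)))) := h2.trans (by gcongr)
      _ = r * C * Real.exp ((1 - α) * (L * (v - 1))) := by ring
      _ ≤ (2 + r * C) * Real.exp (δ + -δ * v) := by
        gcongr
        · linarith
        · have : v - 1 ≤ L * (v - 1) := le_mul_of_one_le_left (by linarith) hL
          nlinarith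
  rcases le_total (-1) v with hv' | hv'
  · have habs : |v| ≤ 1 := abs_le.2 ⟨hv', hv⟩
    calc _ ≤ (r * C) * 1 := by rw [mul_one]; exact h2.trans (by gcongr)
      _ ≤ (2 + r * C) * Real.exp (δ + -δ * |v|) := by
        gcongr
        · linarith
        · exact Real.one_le_exp (by nlinarith)
  · rw [abs_of_nonpos (by linarith)]
    have hLexp : L ≤ 2 * Real.exp (-(L * v) / 2) := by
      have := Real.add_one_le_exp (-(L * v) / 2)
      nlinarith
    calc _ ≤ L * Real.exp (L * v) := h1
      _ ≤ 2 * Real.exp (-(L * v) / 2) * Real.exp (L * v) := by gcongr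
      _ = 2 * Real.exp (L * v / 2) := by rw [mul_assoc, ← Real.exp_add]; ring_nf
      _ ≤ (2 + r * C) * Real.exp (δ + -δ * -v) := by
        gcongr
        · linarith
        · nlinarith

lemma tendsto_exp_mul_atTop_of_neg {v : ℝ} (hv : v < 0) :
    Tendsto (fun L : ℝ => Real.exp (L * v)) atTop (nhds 0) :=
  Real.tendsto_exp_atBot.comp (tendsto_id.atTop_mul_const_of_neg hv)

lemma tendsto_logIntegrand_of_neg {α τ r v : ℝ} (hα : 0 < α) (hτ : 0 ≤ τ) (hr : 0 ≤ r)
    (hv : v < 0) : Tendsto (fun L => logIntegrand α τ r L v) atTop (nhds 0) := by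
  have h : Tendsto (fun L : ℝ => L * Real.exp (L * v)) atTop (nhds 0) := by
    have := Real.tendsto_pow_mul_exp_neg_atTop_nhds_zero 1
    have h1 := (this.comp (tendsto_id.atTop_mul_const (neg_pos.2 hv))).mul_const (-v)⁻¹
    rw [zero_mul] at h1
    refine h1.congr fun L => ?_
    simp only [Function.comp, id, pow_one, mul_neg, neg_neg]
    have := hv.ne
    field_simp
  have h' := h.neg
  rw [neg_zero] at h'
  refine tendsto_of_tendsto_of_tendsto_of_le_of_le' h' tendsto_const_nhds ?_ ?_
  · filter_upwards [eventually_gt_atTop 0] with L hL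
    linarith [(logIntegrand_nonpos_and_le hα hτ hr hL v).2.1]
  · filter_upwards [eventually_gt_atTop 0] with L hL using
      (logIntegrand_nonpos_and_le hα hτ hr hL v).1

lemma tendsto_logIntegrand_of_one_lt {α τ r v : ℝ} (hα : 1 < α) (hτ : 0 ≤ τ) (hr : 0 ≤ r)
    (hv : 1 < v) : Tendsto (fun L => logIntegrand α τ r L v) atTop (nhds 0) := by
  obtain ⟨C, hC, hK⟩ := exists_auxK_le hα hτ
  have h : Tendsto (fun L : ℝ => -(r * C * Real.exp (L * ((1 - α) * (v - 1))))) atTop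
      (nhds 0) := by
    simpa using ((tendsto_exp_mul_atTop_of_neg
      (mul_neg_of_neg_of_pos (by linarith : 1 - α < 0) (sub_pos.2 hv))).const_mul (r * C)).neg
  refine tendsto_of_tendsto_of_tendsto_of_le_of_le' h tendsto_const_nhds ?_ ?_
  · filter_upwards [eventually_gt_atTop 0] with L hL
    have h1 := (logIntegrand_nonpos_and_le (by linarith : 0 < α) hτ hr hL v).2.2.1
    have h2 := mul_le_mul_of_nonneg_left (hK _ (Real.exp_pos (L * (v - 1)))).2 hr
    rw [exp_mul_rpow_eq, ← mul_assoc, mul_left_comm (1 - α)] at h2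
    linarith
  · filter_upwards [eventually_gt_atTop 0] with L hL using
      (logIntegrand_nonpos_and_le (by linarith) hτ hr hL v).1

lemma tendsto_logIntegrand_of_mem_Ioo {α τ r v : ℝ} (hα : 0 < α) (hτ : 0 ≤ τ) (hr : 0 ≤ r)
    (hv : v ∈ Ioo 0 1) :
    Tendsto (fun L => logIntegrand α τ r L v) atTop (nhds (-(r * (τ ^ α / α)))) := by
  have hK : Tendsto (fun L => auxK α τ (Real.exp (L * (v - 1)))) atTop (nhds (τ ^ α / α)) :=
    (tendsto_auxK_nhdsGT_zero hα hτ).comp (tendsto_nhdsWithin_iff.2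
      ⟨tendsto_exp_mul_atTop_of_neg (by linarith [hv.2]),
        Eventually.of_forall fun _ => Real.exp_pos _⟩)
  have hX : Tendsto (fun L : ℝ => (Real.exp (L * v))⁻¹) atTop (nhds 0) :=
    (Real.tendsto_exp_atTop.comp (tendsto_id.atTop_mul_const hv.1)).inv_tendsto_atTop
  have hy := ((tendsto_inv_atTop_zero (𝕜 := ℝ)).const_mul r).mul (hK.mul hX)
  have hrK := hK.const_mul r
  have hlow := hrK.div (hy.const_add 1) (by simp)
  simp only [mul_zero, add_zero, div_one] at hlow
  rw [← tendsto_neg_iff, neg_neg]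
  refine tendsto_of_tendsto_of_tendsto_of_le_of_le' hlow hrK ?_ ?_
  · filter_upwards [eventually_gt_atTop 0] with L hL using
      (logIntegrand_nonpos_and_le hα hτ hr hL v).2.2.2
  · filter_upwards [eventually_gt_atTop 0] with L hL using
      (logIntegrand_nonpos_and_le hα hτ hr hL v).2.2.1

lemma tendsto_integral_logIntegrand {α τ r : ℝ} (hα : 1 < α) (hτ : 0 ≤ τ) (hr : 0 ≤ r) :
    Tendsto (fun L => ∫ v, logIntegrand α τ r L v) atTop (nhds (-(r * (τ ^ α / α)))) := by
  obtain ⟨B, δ, hδ, hB⟩ := exists_abs_logIntegrand_le hα hτ hr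
  have hα0 : 0 < α := by linarith
  have hlim : ∫ v, (Ioo (0:ℝ) 1).indicator (fun _ => -(r * (τ ^ α / α))) v
      = -(r * (τ ^ α / α)) := by
    rw [integral_indicator measurableSet_Ioo]
    simp
  rw [← hlim]
  refine tendsto_integral_filter_of_dominated_convergence (fun v => B * Real.exp (-δ * |v|))
    (Eventually.of_forall fun L => (measurable_logIntegrand α τ r L).aestronglyMeasurable) ?_
    ((integrable_exp_neg_mul_abs hδ).const_mul B) ?_
  · filter_upwards [eventually_ge_atTop 1] with L hL using Eventually.of_forall (hB L hL)
  · filter_upwards [Measure.ae_ne volume (0:ℝ), Measure.ae_ne volume (1:ℝ)] with v hv0 hv1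
    rcases lt_or_gt_of_ne hv0 with h0 | h0
    · rw [indicator_of_notMem fun h => lt_asymm h0 h.1]
      exact tendsto_logIntegrand_of_neg hα0 hτ hr h0
    rcases lt_or_gt_of_ne hv1 with h1 | h1
    · rw [indicator_of_mem (mem_Ioo.2 ⟨h0, h1⟩)]
      exact tendsto_logIntegrand_of_mem_Ioo hα0 hτ hr ⟨h0, h1⟩
    · rw [indicator_of_notMem fun h => lt_asymm h1 h.2]
      exact tendsto_logIntegrand_of_one_lt hα hτ hr h1

lemma tendsto_log_one_div_nhdsWithin_Ioo :
    Tendsto (fun c : ℝ => Real.log (1 / c)) (nhdsWithin 0 (Ioo 0 1)) atTop := by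
  have h := (Real.tendsto_log_nhdsGT_zero.mono_left
    (nhdsWithin_mono 0 (Ioo_subset_Ioi_self : Ioo (0:ℝ) 1 ⊆ Ioi 0)))
  refine (tendsto_neg_atBot_atTop.comp h).congr fun c => ?_
  simp

/-- the small-scale asymptotic self-similarity limit of `Z_{α,1}`
towards `V_{α,1}·τ` with logarithmic normalization (Proposition 3.1(v),
case `β = 1 < α`), at the level of characteristic exponents with `ω ≡ 1`:
with `K_c(x) := c^{−α} ∫_ℝ |f_{cτ}(x,s)|^α ds`,
`lim_{c→0} ∫_0^∞ (exp(−r(log(1/c))^{−1}K_c(x)) − 1) dx = −rτ^α/α`; moreover the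
auxiliary function `K̃(w)` satisfies `lim_{w→0} K̃(w) = τ^α/α`. -/
theorem stmt_14 (α τ r : ℝ) (hα1 : 1 < α) (hα2 : α ≤ 2) (hτ : 0 < τ) (hr : 0 < r) :
    Filter.Tendsto (fun c : ℝ =>
        ∫ x in Set.Ioi (0:ℝ),
          (Real.exp (-r * (Real.log (1 / c))⁻¹
            * (c ^ (-α) * ∫ s : ℝ, |fker (c * τ) x s| ^ α)) - 1))
      (nhdsWithin 0 (Set.Ioo 0 1)) (nhds (-r * τ ^ α / α)) ∧
    Filter.Tendsto (fun w : ℝ =>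
        (1 / α) * ((1 - Real.exp (-w * τ)) / w) ^ α
          + w * ∫ s in Set.Ioc (0:ℝ) τ, ((1 - Real.exp (-w * s)) / w) ^ α)
      (nhdsWithin 0 (Set.Ioi 0)) (nhds (τ ^ α / α)) := by
  refine ⟨?_, tendsto_auxK_nhdsGT_zero (by linarith) hτ.le⟩
  have h := (tendsto_integral_logIntegrand hα1 hτ.le hr.le).comp
    tendsto_log_one_div_nhdsWithin_Ioo
  have e : -r * τ ^ α / α = -(r * (τ ^ α / α)) := by ring
  rw [e]
  refine h.congr' ?_
  filter_upwards [self_mem_nhdsWithin] with c hc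
  exact (integral_exponent_eq (by linarith) hτ.le hc).symm
end

section
/- Let 0 < β < α ≤ 2, d ∈ ℕ, θ₁, …, θ_d ∈ ℝ and 0 < τ₁ < … < τ_d. Define G(θ₁,…,θ_d; τ₁,…,τ_d) := ∫_0^∞ (exp(−∫_ℝ |Σ_{j=1}^d θ_j f_{τ_j}(x,s)|^α ds) − 1) x^{β−1} dx. Then for every c > 0, G(θ₁,…,θ_d; τ₁/c,…,τ_d/c) = c^β · G(c^{−(1+α)/α} θ₁,…,c^{−(1+α)/α} θ_d; τ₁,…,τ_d). -/
open MeasureTheory Filter Set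

theorem fker_div {τ c : ℝ} (hτ : 0 ≤ τ) (hc : 0 < c) (x s : ℝ) :
    fker (τ / c) x s = c⁻¹ * fker τ (c⁻¹ * x) (c * s) := by
  unfold fker
  rw [← intervalIntegral.integral_of_le hτ, ← intervalIntegral.integral_of_le (by positivity)]
  have h := intervalIntegral.integral_comp_mul_left
    (fun t ↦ if c * s ≤ t then Real.exp (-(c⁻¹ * x) * (t - c * s)) else 0)
    (a := 0) (b := τ / c) hc.ne'
  rw [mul_zero, mul_div_cancel₀ _ hc.ne', smul_eq_mul] at h
  rw [← h]
  congr 1 with t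
  simp only [mul_le_mul_iff_right₀ hc]
  congr 2
  field_simp

theorem integral_abs_sum_fker_div_rpow {ι : Type*} [Fintype ι] {α c : ℝ} (hα : 0 < α) (hc : 0 < c)
    (θ τ : ι → ℝ) (hτ : ∀ j, 0 ≤ τ j) (x : ℝ) :
    ∫ s : ℝ, |∑ j, θ j * fker (τ j / c) x s| ^ α =
      ∫ s : ℝ, |∑ j, (c ^ (-((1 + α) / α)) * θ j) * fker (τ j) (c⁻¹ * x) s| ^ α := by
  have hpow : (c ^ (-((1 + α) / α))) ^ α = c⁻¹ * c⁻¹ ^ α := by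
    rw [← Real.rpow_mul hc.le, Real.inv_rpow hc.le, ← Real.rpow_neg_one c, ← Real.rpow_neg hc.le,
      ← Real.rpow_add hc]
    congr 1
    field_simp
    ring
  have h := Measure.integral_comp_mul_left
    (fun s ↦ |∑ j, θ j * fker (τ j) (c⁻¹ * x) s| ^ α) c
  rw [smul_eq_mul, abs_of_pos (inv_pos.2 hc)] at h
  have hl (s : ℝ) : |∑ j, θ j * fker (τ j / c) x s| ^ α =
      c⁻¹ ^ α * |∑ j, θ j * fker (τ j) (c⁻¹ * x) (c * s)| ^ α := by
    simp only [fker_div (hτ _) hc, mul_left_comm _ c⁻¹, ← Finset.mul_sum]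
    rw [abs_mul, abs_of_pos (inv_pos.2 hc), Real.mul_rpow (by positivity) (abs_nonneg _)]
  have hr (s : ℝ) : |∑ j, (c ^ (-((1 + α) / α)) * θ j) * fker (τ j) (c⁻¹ * x) s| ^ α =
      c⁻¹ * c⁻¹ ^ α * |∑ j, θ j * fker (τ j) (c⁻¹ * x) s| ^ α := by
    simp only [mul_assoc (c ^ (-((1 + α) / α))), ← Finset.mul_sum]
    rw [abs_mul, abs_of_pos (by positivity), Real.mul_rpow (by positivity) (abs_nonneg _), hpow]
  simp only [hl, hr, integral_const_mul, h]
  ring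

theorem integral_Ioi_comp_inv_mul_mul_rpow {c : ℝ} (hc : 0 < c) (β : ℝ) (F : ℝ → ℝ) :
    ∫ x in Set.Ioi (0 : ℝ), F (c⁻¹ * x) * x ^ (β - 1) =
      c ^ β * ∫ x in Set.Ioi (0 : ℝ), F x * x ^ (β - 1) := by
  have h := integral_comp_mul_left_Ioi (fun x ↦ F x * x ^ (β - 1)) 0 (inv_pos.2 hc)
  rw [mul_zero, inv_inv, smul_eq_mul] at h
  have hcongr : ∫ x in Set.Ioi (0 : ℝ), F (c⁻¹ * x) * x ^ (β - 1) =
      ∫ x in Set.Ioi (0 : ℝ), c ^ (β - 1) * (F (c⁻¹ * x) * (c⁻¹ * x) ^ (β - 1)) := by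
    refine setIntegral_congr_fun measurableSet_Ioi fun x hx ↦ ?_
    have hx' : (0 : ℝ) < x := hx
    have : x ^ (β - 1) = c ^ (β - 1) * (c⁻¹ * x) ^ (β - 1) := by
      rw [← Real.mul_rpow hc.le (by positivity), mul_inv_cancel_left₀ hc.ne']
    rw [this]
    ring
  rw [hcongr, integral_const_mul, h, ← mul_assoc, Real.rpow_sub_one hc.ne',
    div_mul_cancel₀ _ hc.ne']

/-- the scaling identity for the characteristic exponent
`G(θ;τ) := ∫_0^∞ (exp(−∫_ℝ |Σ_j θ_j f_{τ_j}(x,s)|^α ds) − 1) x^{β−1} dx`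
of the intermediate process `Z_{α,β}` (symmetric case `ω ≡ 1`, `ψ₁ = 1`):
`G(θ; τ/c) = c^β G(c^{−(1+α)/α} θ; τ)`, which with `c = N^{1/β}` is the
aggregate-similarity property (3.7). -/
theorem stmt_15 (α β : ℝ) (hβ0 : 0 < β) (hβα : β < α) (hα2 : α ≤ 2)
    (d : ℕ) (hd : 0 < d) (θ τv : Fin d → ℝ)
    (hτpos : ∀ j, 0 < τv j) (hτmono : StrictMono τv)
    (c : ℝ) (hc : 0 < c) :
    (∫ x in Set.Ioi (0:ℝ),
        (Real.exp (-(∫ s : ℝ, |∑ j, θ j * fker (τv j / c) x s| ^ α)) - 1) * x ^ (β - 1))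
      = c ^ β * (∫ x in Set.Ioi (0:ℝ),
          (Real.exp (-(∫ s : ℝ,
            |∑ j, (c ^ (-((1 + α) / α)) * θ j) * fker (τv j) x s| ^ α)) - 1)
            * x ^ (β - 1)) := by
  simp only [integral_abs_sum_fker_div_rpow (hβ0.trans hβα) hc θ τv fun j ↦ (hτpos j).le]
  exact integral_Ioi_comp_inv_mul_mul_rpow hc β fun x ↦ Real.exp (-(∫ s : ℝ,
    |∑ j, (c ^ (-((1 + α) / α)) * θ j) * fker (τv j) x s| ^ α)) - 1
end

section
/- Let 0 < α ≤ 2 and β > max(α,1). Let ψ: [0,1) → [0,∞) be integrable with a finite limit lim_{u↑1} ψ(u) = ψ₁ > 0, and set φ(u) := ψ(u)(1−u)^{β−1}, assuming φ is a probability density on [0,1). Let d ∈ ℕ, θ₁, …, θ_d ∈ ℝ, 0 = τ₀ < τ₁ < … < τ_d, and define K_n(u) := n^{−1} Σ_{s ∈ ℤ} |ϑ_n(u,s)|^α for u ∈ [0,1). Then κ_α := ∫_0^1 (1−u)^{−α} φ(u) du < ∞, and for any sequences N_k → ∞, n_k → ∞, lim_{k→∞} N_k ∫_0^1 (exp(−N_k^{−1}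 K_{n_k}(u)) − 1) φ(u) du = −κ_α Σ_{i=1}^d (τ_i − τ_{i−1}) |Σ_{j=i}^d θ_j|^α. -/
open MeasureTheory Filter Set

/-- `ϑ_n(u,s) := Σ_{j=1}^d θ_j Σ_{t=1}^{⌊nτ_j⌋} u^{t−s} 1(s ≤ t)`. -/
noncomputable def vth (d : ℕ) (θ τ : ℕ → ℝ) (n : ℕ) (u : ℝ) (s : ℤ) : ℝ :=
  ∑ j ∈ Finset.Icc 1 d, θ j *
    ∑ t ∈ Finset.Icc 1 ⌊(n : ℝ) * τ j⌋₊,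
      if s ≤ (t : ℤ) then u ^ ((t : ℤ) - s).toNat else 0

theorem abs_sum_rpow_le_sum_abs_rpow {ι : Type*} (S : Finset ι) (f : ι → ℝ) {p : ℝ}
    (hp0 : 0 < p) (hp1 : p ≤ 1) : |∑ i ∈ S, f i| ^ p ≤ ∑ i ∈ S, |f i| ^ p := by
  refine Finset.le_sum_of_subadditive (fun x : ℝ => |x| ^ p) ?_ (fun x y => ?_) S f
  · simp [Real.zero_rpow hp0.ne']
  · exact (Real.rpow_le_rpow (abs_nonneg _) (abs_add_le x y) hp0.le).trans
      (Real.rpow_add_le_add_rpow (abs_nonneg _) (abs_nonneg _) hp0.le hp1)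

theorem abs_rpow_sub_rpow_le_of_le_one {p : ℝ} (hp0 : 0 < p) (hp1 : p ≤ 1) (x y : ℝ) :
    |(|x| ^ p - |y| ^ p)| ≤ |x - y| ^ p := by
  have key : ∀ a b : ℝ, |a| ^ p - |b| ^ p ≤ |a - b| ^ p := fun a b => by
    have h := (Real.rpow_le_rpow (abs_nonneg a)
      (by simpa using abs_add_le (a - b) b) hp0.le).trans
      (Real.rpow_add_le_add_rpow (abs_nonneg (a - b)) (abs_nonneg b) hp0.le hp1)
    linarith
  refine abs_sub_le_iff.2 ⟨key x y, ?_⟩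
  rw [abs_sub_comm x y]
  exact key y x

theorem abs_rpow_sub_rpow_le_of_one_le {p B x y : ℝ} (hp : 1 ≤ p) (hx : |x| ≤ B) (hy : |y| ≤ B) :
    |(|x| ^ p - |y| ^ p)| ≤ p * B ^ (p - 1) * |x - y| := by
  have h := (convex_Icc 0 B).norm_image_sub_le_of_norm_deriv_le (𝕜 := ℝ)
    (f := fun t : ℝ => t ^ p) (C := p * B ^ (p - 1))
    (fun t _ => Real.differentiable_rpow_const hp t)
    (fun t ht => ?_) ⟨abs_nonneg y, hy⟩ ⟨abs_nonneg x, hx⟩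
  · refine h.trans ?_
    have hB : 0 ≤ B := (abs_nonneg x).trans hx
    have : 0 ≤ p := zero_le_one.trans hp
    gcongr
    exact abs_abs_sub_abs_le_abs_sub x y
  · rw [Real.deriv_rpow_const, Real.norm_eq_abs,
      abs_of_nonneg (by have := Real.rpow_nonneg ht.1 (p - 1); positivity)]
    have := ht.1
    have := ht.2
    gcongr

/-- Bounded real numbers satisfy a Hölder estimate for `|·| ^ p` of exponent `min p 1`. -/
theorem exists_abs_rpow_sub_rpow_le {p : ℝ} (hp : 0 < p) (B : ℝ) :
    ∃ C, 0 ≤ C ∧ ∀ x y : ℝ, |x| ≤ B → |y| ≤ B →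
      |(|x| ^ p - |y| ^ p)| ≤ C * |x - y| ^ min p 1 := by
  rcases le_total p 1 with h | h
  · exact ⟨1, zero_le_one, fun x y _ _ => by
      simpa [min_eq_left h] using abs_rpow_sub_rpow_le_of_le_one hp h x y⟩
  · refine ⟨|p * B ^ (p - 1)|, abs_nonneg _, fun x y hx hy => ?_⟩
    rw [min_eq_right h, Real.rpow_one]
    exact (abs_rpow_sub_rpow_le_of_one_le h hx hy).trans (by gcongr; exact le_abs_self _)

/-- The moving-average coefficient `u ^ (t - s)` of the innovation `s` at time `t`. -/
noncomputable def arCoeff (u : ℝ) (t s : ℤ) : ℝ :=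
  if s ≤ t then u ^ (t - s).toNat else 0

section arCoeff

variable {u : ℝ}

theorem arCoeff_nonneg (hu : 0 ≤ u) (t s : ℤ) : 0 ≤ arCoeff u t s := by
  unfold arCoeff; split_ifs <;> positivity

theorem arCoeff_le_one (hu : 0 ≤ u) (hu1 : u ≤ 1) (t s : ℤ) : arCoeff u t s ≤ 1 := by
  unfold arCoeff; split_ifs
  exacts [pow_le_one₀ hu hu1, zero_le_one]

theorem mul_arCoeff_sub_one (u : ℝ) (t s : ℤ) :
    u * arCoeff u (t - 1) s = arCoeff u t s - if s = t then 1 else 0 := by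
  unfold arCoeff
  rcases lt_trichotomy s t with h | rfl | h
  · rw [if_pos (by omega), if_pos h.le, if_neg h.ne, ← pow_succ', sub_zero]
    congr 1; omega
  · simp
  · simp [h.not_ge, h.ne', show ¬ s ≤ t - 1 by omega]

theorem one_sub_mul_sum_arCoeff (u : ℝ) (m : ℕ) (s : ℤ) :
    (1 - u) * ∑ t ∈ Finset.Icc 1 m, arCoeff u t s =
      (if s ∈ Finset.Ioc 0 (m : ℤ) then 1 else 0) + u * arCoeff u 0 s - u * arCoeff u m s := by
  induction m with
  | zero => simp
  | succ m ih =>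
    rw [Finset.sum_Icc_succ_top (by omega), mul_add, ih]
    have h := mul_arCoeff_sub_one u (m + 1 : ℤ) s
    rw [add_sub_cancel_right] at h
    have hi : (if s ∈ Finset.Ioc 0 ((m + 1 : ℕ) : ℤ) then (1 : ℝ) else 0) =
        (if s ∈ Finset.Ioc 0 (m : ℤ) then 1 else 0) + if s = m + 1 then 1 else 0 := by
      by_cases h1 : s = m + 1
      · subst h1
        simp [show (0 : ℤ) < m + 1 by omega]
      · have : s ∈ Finset.Ioc 0 ((m + 1 : ℕ) : ℤ) ↔ s ∈ Finset.Ioc 0 (m : ℤ) := by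
          simp only [Finset.mem_Ioc]; omega
        rw [if_congr this rfl rfl, if_neg h1, add_zero]
    rw [hi]
    push_cast
    linear_combination -h

theorem hasSum_arCoeff_rpow (hu : 0 ≤ u) (hu1 : u < 1) {p : ℝ} (hp : 0 < p) (t : ℤ) :
    HasSum (fun s => arCoeff u t s ^ p) (1 - u ^ p)⁻¹ := by
  have hinj : Function.Injective (fun k : ℕ => t - (k : ℤ)) := fun a b h => by
    simpa using h
  refine (hinj.hasSum_iff fun s hs => ?_).1 ?_
  · rw [arCoeff, if_neg, Real.zero_rpow hp.ne']
    exact fun h => hs ⟨(t - s).toNat, by simp [h]⟩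
  · convert hasSum_geometric_of_lt_one (Real.rpow_nonneg hu p) (Real.rpow_lt_one hu hu1 hp) using 2
      with k
    simp [arCoeff, Real.rpow_pow_comm hu]

theorem inv_one_sub_rpow_le (hu : 0 ≤ u) (hu1 : u < 1) {p : ℝ} (hp : 0 < p) (hp1 : p ≤ 1) :
    (1 - u ^ p)⁻¹ ≤ p⁻¹ * (1 - u)⁻¹ := by
  rw [← mul_inv]
  have h := rpow_one_add_le_one_add_mul_self (s := u - 1) (by linarith) hp.le hp1
  rw [add_sub_cancel] at h
  exact inv_anti₀ (mul_pos hp (by linarith)) (by linarith)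

theorem abs_sum_arCoeff_le (hu : 0 ≤ u) (hu1 : u < 1) (m : ℕ) (s : ℤ) :
    |∑ t ∈ Finset.Icc 1 m, arCoeff u (t : ℕ) s| ≤ 2 * (1 - u)⁻¹ := by
  have h1u : 0 < 1 - u := sub_pos.2 hu1
  rw [abs_of_nonneg (Finset.sum_nonneg fun t _ => arCoeff_nonneg hu _ s), ← div_eq_mul_inv,
    le_div_iff₀' h1u, one_sub_mul_sum_arCoeff]
  have h0 := arCoeff_le_one hu hu1.le 0 s
  have h0' := arCoeff_nonneg hu 0 s
  have hm := mul_nonneg hu (arCoeff_nonneg hu m s)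
  split_ifs <;> nlinarith

end arCoeff

/-- The coefficient of the innovation `s` in the linear combination of the partial sums up to the
times `M j` with weights `θ j`. -/
noncomputable def aggCoeff (d : ℕ) (θ : ℕ → ℝ) (M : ℕ → ℕ) (u : ℝ) (s : ℤ) : ℝ :=
  ∑ j ∈ Finset.Icc 1 d, θ j * ∑ t ∈ Finset.Icc 1 (M j), arCoeff u t s

/-- The coefficient of the innovation `s` in the linear combination of the partial sums of the
innovations themselves. -/
noncomputable def stepCoeff (d : ℕ) (θ : ℕ → ℝ) (M : ℕ → ℕ) (s : ℤ) : ℝ :=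
  ∑ j ∈ Finset.Icc 1 d, θ j * if s ∈ Finset.Ioc 0 (M j : ℤ) then 1 else 0

section aggCoeff

variable (d : ℕ) (θ : ℕ → ℝ) (M : ℕ → ℕ) {u α p : ℝ}

theorem abs_aggCoeff_le (hu : 0 ≤ u) (hu1 : u < 1) (s : ℤ) :
    |aggCoeff d θ M u s| ≤ 2 * (∑ j ∈ Finset.Icc 1 d, |θ j|) * (1 - u)⁻¹ := by
  refine (Finset.abs_sum_le_sum_abs _ _).trans ?_
  rw [mul_comm 2, mul_assoc, Finset.sum_mul]
  gcongr with j
  rw [abs_mul]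
  gcongr
  exact abs_sum_arCoeff_le hu hu1 _ s

theorem abs_stepCoeff_le (s : ℤ) :
    |stepCoeff d θ M s| ≤ ∑ j ∈ Finset.Icc 1 d, |θ j| := by
  refine (Finset.abs_sum_le_sum_abs _ _).trans ?_
  refine Finset.sum_le_sum fun j _ => ?_
  split_ifs <;> simp

theorem abs_aggCoeff_rpow_le_of_le_one (hu : 0 ≤ u) (hp : 0 < p) (hp1 : p ≤ 1) (s : ℤ) :
    |aggCoeff d θ M u s| ^ p ≤
      ∑ j ∈ Finset.Icc 1 d, |θ j| ^ p * ∑ t ∈ Finset.Icc 1 (M j), arCoeff u t s ^ p := by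
  refine (abs_sum_rpow_le_sum_abs_rpow _ _ hp hp1).trans ?_
  gcongr with j
  rw [abs_mul, Real.mul_rpow (abs_nonneg _) (abs_nonneg _)]
  gcongr
  refine (abs_sum_rpow_le_sum_abs_rpow _ _ hp hp1).trans (Finset.sum_le_sum fun t _ => ?_)
  rw [abs_of_nonneg (arCoeff_nonneg hu _ s)]

theorem abs_aggCoeff_rpow_le (hu : 0 ≤ u) (hu1 : u < 1) (hα : 0 < α) (s : ℤ) :
    |aggCoeff d θ M u s| ^ α ≤
      (2 * (∑ j ∈ Finset.Icc 1 d, |θ j|) * (1 - u)⁻¹) ^ (α - min α 1) *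
        ∑ j ∈ Finset.Icc 1 d, |θ j| ^ min α 1 *
          ∑ t ∈ Finset.Icc 1 (M j), arCoeff u t s ^ min α 1 := by
  have hγ : 0 < min α 1 := lt_min hα one_pos
  have hγ' : 0 ≤ α - min α 1 := sub_nonneg.2 (min_le_left _ _)
  conv_lhs => rw [← sub_add_cancel α (min α 1)]
  rw [Real.rpow_add_of_nonneg (abs_nonneg _) hγ' hγ.le]
  have h1 := Real.rpow_le_rpow (abs_nonneg _) (abs_aggCoeff_le d θ M hu hu1 s) hγ'
  exact mul_le_mul h1 (abs_aggCoeff_rpow_le_of_le_one d θ M hu hγ (min_le_right _ _) s)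
    (by positivity) ((Real.rpow_nonneg (abs_nonneg _) _).trans h1)

theorem hasSum_sum_arCoeff_rpow (hu : 0 ≤ u) (hu1 : u < 1) (hp : 0 < p) :
    HasSum (fun s => ∑ j ∈ Finset.Icc 1 d, |θ j| ^ p *
        ∑ t ∈ Finset.Icc 1 (M j), arCoeff u t s ^ p)
      (∑ j ∈ Finset.Icc 1 d, |θ j| ^ p * (M j * (1 - u ^ p)⁻¹)) := by
  refine hasSum_sum fun j _ => HasSum.mul_left _ ?_
  have h := hasSum_sum (s := Finset.Icc 1 (M j))
    fun t _ => hasSum_arCoeff_rpow hu hu1 hp (t : ℤ)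
  simpa using h

theorem summable_abs_aggCoeff_rpow (hu : 0 ≤ u) (hu1 : u < 1) (hα : 0 < α) :
    Summable fun s => |aggCoeff d θ M u s| ^ α :=
  Summable.of_nonneg_of_le (fun _ => by positivity)
    (abs_aggCoeff_rpow_le d θ M hu hu1 hα)
    ((hasSum_sum_arCoeff_rpow d θ M hu hu1 (lt_min hα one_pos)).summable.mul_left _)

theorem tsum_abs_aggCoeff_rpow_le (hu : 0 ≤ u) (hu1 : u < 1) (hα : 0 < α) :
    ∑' s, |aggCoeff d θ M u s| ^ α ≤
      (2 * ∑ j ∈ Finset.Icc 1 d, |θ j|) ^ (α - min α 1) * (min α 1)⁻¹ *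
        (∑ j ∈ Finset.Icc 1 d, |θ j| ^ min α 1 * M j) * (1 - u) ^ (-max α 1) := by
  have hγ : 0 < min α 1 := lt_min hα one_pos
  have h1u : 0 < 1 - u := sub_pos.2 hu1
  have h := (hasSum_sum_arCoeff_rpow d θ M hu hu1 hγ).mul_left
    ((2 * (∑ j ∈ Finset.Icc 1 d, |θ j|) * (1 - u)⁻¹) ^ (α - min α 1))
  refine ((summable_abs_aggCoeff_rpow d θ M hu hu1 hα).tsum_le_tsum
    (abs_aggCoeff_rpow_le d θ M hu hu1 hα) h.summable).trans ?_
  have hΘ : 0 ≤ 2 * ∑ j ∈ Finset.Icc 1 d, |θ j| := by positivity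
  have hexp : (1 - u) ^ (-max α 1) = (1 - u)⁻¹ ^ (α - min α 1) * (1 - u)⁻¹ := by
    rw [Real.inv_rpow h1u.le, ← Real.rpow_neg h1u.le, ← Real.rpow_neg_one (1 - u),
      ← Real.rpow_add h1u]
    congr 1
    linarith [min_add_max α 1]
  simp only [h.tsum_eq, ← mul_assoc, ← Finset.sum_mul]
  rw [Real.mul_rpow hΘ (inv_nonneg.2 h1u.le), hexp]
  calc _ ≤ (2 * ∑ j ∈ Finset.Icc 1 d, |θ j|) ^ (α - min α 1) * (1 - u)⁻¹ ^ (α - min α 1) *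
        (∑ j ∈ Finset.Icc 1 d, |θ j| ^ min α 1 * M j) * ((min α 1)⁻¹ * (1 - u)⁻¹) := by
        gcongr
        exact inv_one_sub_rpow_le hu hu1 hγ (min_le_right _ _)
    _ = _ := by ring

theorem aggCoeff_sub_stepCoeff (hu1 : u < 1) (s : ℤ) :
    aggCoeff d θ M u s - (1 - u)⁻¹ * stepCoeff d θ M s =
      ∑ j ∈ Finset.Icc 1 d, (1 - u)⁻¹ * (θ j * (u * (arCoeff u 0 s - arCoeff u (M j) s))) := by
  rw [aggCoeff, stepCoeff, Finset.mul_sum, ← Finset.sum_sub_distrib]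
  refine Finset.sum_congr rfl fun j _ => ?_
  have h1u : 1 - u ≠ 0 := (sub_pos.2 hu1).ne'
  have h := one_sub_mul_sum_arCoeff u (M j) s
  rw [eq_inv_mul_iff_mul_eq₀ h1u, mul_sub, mul_inv_cancel_left₀ h1u]
  linear_combination θ j * h

theorem abs_aggCoeff_sub_stepCoeff_rpow_le (hu : 0 ≤ u) (hu1 : u < 1) (hp : 0 < p) (hp1 : p ≤ 1)
    (s : ℤ) :
    |aggCoeff d θ M u s - (1 - u)⁻¹ * stepCoeff d θ M s| ^ p ≤
      ∑ j ∈ Finset.Icc 1 d, (1 - u)⁻¹ ^ p * (|θ j| ^ p *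
        (arCoeff u 0 s ^ p + arCoeff u (M j) s ^ p)) := by
  rw [aggCoeff_sub_stepCoeff d θ M hu1]
  refine (abs_sum_rpow_le_sum_abs_rpow _ _ hp hp1).trans ?_
  have h1u : 0 < (1 - u)⁻¹ := inv_pos.2 (sub_pos.2 hu1)
  gcongr with j
  rw [abs_mul, abs_mul, abs_of_pos h1u, Real.mul_rpow h1u.le (by positivity),
    Real.mul_rpow (abs_nonneg _) (abs_nonneg _)]
  have h0 := arCoeff_nonneg hu 0 s
  have hM := arCoeff_nonneg hu (M j) s
  gcongr
  refine (Real.rpow_le_rpow (abs_nonneg _) ?_ hp.le).trans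
    (Real.rpow_add_le_add_rpow h0 hM hp.le hp1)
  rw [abs_mul, abs_of_nonneg hu]
  have : |arCoeff u 0 s - arCoeff u (M j) s| ≤ arCoeff u 0 s + arCoeff u (M j) s :=
    abs_sub_le_iff.2 ⟨by linarith, by linarith⟩
  exact (mul_le_of_le_one_left (abs_nonneg _) hu1.le).trans this

theorem stepCoeff_eq_zero {s : ℤ} (hmono : ∀ j ∈ Finset.Icc 1 d, M j ≤ M d)
    (hs : s ∉ Finset.Ioc 0 (M d : ℤ)) : stepCoeff d θ M s = 0 := by
  refine Finset.sum_eq_zero fun j hj => ?_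
  have := hmono j hj
  rw [if_neg, mul_zero]
  simp only [Finset.mem_Ioc] at hs ⊢
  omega

theorem exists_abs_tsum_sub_tsum_le (hu : 0 ≤ u) (hu1 : u < 1) (hα : 0 < α) :
    ∃ C, ∀ M : ℕ → ℕ, (∀ j ∈ Finset.Icc 1 d, M j ≤ M d) →
      |∑' s, |aggCoeff d θ M u s| ^ α - ∑' s, |(1 - u)⁻¹ * stepCoeff d θ M s| ^ α| ≤ C := by
  obtain ⟨C, hC0, hC⟩ := exists_abs_rpow_sub_rpow_le hα
    (2 * (∑ j ∈ Finset.Icc 1 d, |θ j|) * (1 - u)⁻¹)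
  have hγ : 0 < min α 1 := lt_min hα one_pos
  have h1u : 0 < (1 - u)⁻¹ := inv_pos.2 (sub_pos.2 hu1)
  refine ⟨C * ∑ j ∈ Finset.Icc 1 d, (1 - u)⁻¹ ^ min α 1 * (|θ j| ^ min α 1 *
    ((1 - u ^ min α 1)⁻¹ + (1 - u ^ min α 1)⁻¹)), fun M hM => ?_⟩
  have hstep : Summable fun s => |(1 - u)⁻¹ * stepCoeff d θ M s| ^ α :=
    summable_of_ne_finset_zero (s := Finset.Ioc 0 (M d : ℤ)) fun s hs => by
      rw [stepCoeff_eq_zero d θ M hM hs]; simp [hα.ne']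
  rw [← (summable_abs_aggCoeff_rpow d θ M hu hu1 hα).tsum_sub hstep, ← Real.norm_eq_abs]
  refine tsum_of_norm_bounded (HasSum.mul_left C <| hasSum_sum fun j _ =>
    ((((hasSum_arCoeff_rpow hu hu1 hγ 0).add (hasSum_arCoeff_rpow hu hu1 hγ (M j))).mul_left
      (|θ j| ^ min α 1)).mul_left ((1 - u)⁻¹ ^ min α 1))) fun s => ?_
  refine (hC _ _ (abs_aggCoeff_le d θ M hu hu1 s) ?_).trans ?_
  · rw [abs_mul, abs_of_pos h1u, mul_comm]
    gcongr
    have := abs_stepCoeff_le d θ M s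
    linarith [abs_nonneg (stepCoeff d θ M s)]
  · gcongr
    exact abs_aggCoeff_sub_stepCoeff_rpow_le d θ M hu hu1 hγ (min_le_right _ _) s

theorem sum_Ioc_intCast_eq_sum_sum_Ioc (f : ℤ → ℝ) (k : ℕ)
    (hM : ∀ i < k, M i ≤ M (i + 1)) :
    ∑ s ∈ Finset.Ioc (M 0 : ℤ) (M k), f s =
      ∑ i ∈ Finset.Icc 1 k, ∑ s ∈ Finset.Ioc (M (i - 1) : ℤ) (M i), f s := by
  induction k with
  | zero => simp
  | succ k ih =>
    rw [Finset.sum_Icc_succ_top (by omega), ← ih fun i hi => hM i (by omega), Nat.add_sub_cancel,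
      ← Finset.sum_union (Finset.Ioc_disjoint_Ioc_of_le le_rfl),
      Finset.Ioc_union_Ioc_eq_Ioc _ (by exact_mod_cast hM k (by omega))]
    have : ∀ l ≤ k, M 0 ≤ M l := fun l => by
      induction l with
      | zero => intro _; exact le_rfl
      | succ l ihl => exact fun hl => (ihl (by omega)).trans (hM l (by omega))
    exact_mod_cast this k le_rfl

theorem tsum_abs_stepCoeff_rpow (hα : 0 < α) (hM0 : M 0 = 0)
    (hM : MonotoneOn M (Set.Iic d)) (c : ℝ) :
    ∑' s, |c * stepCoeff d θ M s| ^ α =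
      |c| ^ α * ∑ i ∈ Finset.Icc 1 d,
        ((M i : ℝ) - M (i - 1)) * |∑ j ∈ Finset.Icc i d, θ j| ^ α := by
  have hMd : ∀ j ∈ Finset.Icc 1 d, M j ≤ M d := fun j hj =>
    hM (Finset.mem_Icc.1 hj).2 (Set.mem_Iic.2 le_rfl) (Finset.mem_Icc.1 hj).2
  rw [tsum_eq_sum (s := Finset.Ioc (M 0 : ℤ) (M d)) fun s hs => by
      rw [stepCoeff_eq_zero d θ M hMd (by simpa [hM0] using hs)]; simp [hα.ne'],
    sum_Ioc_intCast_eq_sum_sum_Ioc M _ d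
      fun i hi => hM (Set.mem_Iic.2 hi.le) (Set.mem_Iic.2 hi) i.le_succ, Finset.mul_sum]
  refine Finset.sum_congr rfl fun i hi => ?_
  rw [Finset.mem_Icc] at hi
  have hle : M (i - 1) ≤ M i := hM (Set.mem_Iic.2 (by omega)) (Set.mem_Iic.2 hi.2) (by omega)
  have hconst : ∀ s ∈ Finset.Ioc (M (i - 1) : ℤ) (M i),
      |c * stepCoeff d θ M s| ^ α = |c| ^ α * |∑ j ∈ Finset.Icc i d, θ j| ^ α := fun s hs => by
    rw [abs_mul, Real.mul_rpow (abs_nonneg _) (abs_nonneg _)]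
    congr 3
    rw [Finset.mem_Ioc] at hs
    simp only [stepCoeff, mul_ite, mul_one, mul_zero]
    rw [← Finset.sum_filter]
    refine Finset.sum_congr (Finset.ext fun j => ?_) fun _ _ => rfl
    simp only [Finset.mem_filter, Finset.mem_Icc, Finset.mem_Ioc]
    constructor
    · rintro ⟨⟨h1, h2⟩, -, h3⟩
      refine ⟨?_, h2⟩
      by_contra! hji
      have := hM (Set.mem_Iic.2 h2) (Set.mem_Iic.2 (by omega : i - 1 ≤ d)) (by omega : j ≤ i - 1)
      omega
    · rintro ⟨h1, h2⟩
      have := hM (Set.mem_Iic.2 hi.2) (Set.mem_Iic.2 h2) h1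
      omega
  rw [Finset.sum_congr rfl hconst, Finset.sum_const, Int.card_Ioc, nsmul_eq_mul,
    show ((M i : ℤ) - M (i - 1)).toNat = M i - M (i - 1) by omega, Nat.cast_sub hle]
  ring

end aggCoeff

theorem tendsto_inv_mul_tsum_abs_aggCoeff_rpow (d : ℕ) (θ τ : ℕ → ℝ) (hτ0 : τ 0 = 0)
    (hτ : MonotoneOn τ (Set.Iic d)) {α u : ℝ} (hα : 0 < α) (hu : 0 ≤ u) (hu1 : u < 1) :
    Tendsto (fun n : ℕ => (n : ℝ)⁻¹ *
        ∑' s, |aggCoeff d θ (fun j => ⌊(n : ℝ) * τ j⌋₊) u s| ^ α) atTop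
      (nhds ((1 - u) ^ (-α) * ∑ i ∈ Finset.Icc 1 d,
        (τ i - τ (i - 1)) * |∑ j ∈ Finset.Icc i d, θ j| ^ α)) := by
  have hM : ∀ n : ℕ, MonotoneOn (fun j => ⌊(n : ℝ) * τ j⌋₊) (Set.Iic d) :=
    fun n i hi j hj hij => Nat.floor_mono (mul_le_mul_of_nonneg_left (hτ hi hj hij) n.cast_nonneg)
  have hτnn : ∀ j ≤ d, 0 ≤ τ j := fun j hj =>
    hτ0 ▸ hτ (Set.mem_Iic.2 d.zero_le) (Set.mem_Iic.2 hj) j.zero_le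
  have hfloor : ∀ j ≤ d, Tendsto (fun n : ℕ => (n : ℝ)⁻¹ * (⌊(n : ℝ) * τ j⌋₊ : ℝ)) atTop
      (nhds (τ j)) := fun j hj => by
    refine ((tendsto_nat_floor_mul_div_atTop (hτnn j hj)).comp
      (tendsto_natCast_atTop_atTop (R := ℝ))).congr fun n => ?_
    simp [div_eq_inv_mul, mul_comm (τ j)]
  have h1u : 0 < 1 - u := sub_pos.2 hu1
  have hstep : Tendsto (fun n : ℕ => (n : ℝ)⁻¹ *
      ∑' s, |(1 - u)⁻¹ * stepCoeff d θ (fun j => ⌊(n : ℝ) * τ j⌋₊) s| ^ α) atTop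
      (nhds ((1 - u) ^ (-α) * ∑ i ∈ Finset.Icc 1 d,
        (τ i - τ (i - 1)) * |∑ j ∈ Finset.Icc i d, θ j| ^ α)) := by
    have hc : |(1 - u)⁻¹| ^ α = (1 - u) ^ (-α) := by
      rw [abs_of_pos (inv_pos.2 h1u), Real.inv_rpow h1u.le, Real.rpow_neg h1u.le]
    refine ((tendsto_finsetSum (Finset.Icc 1 d) fun i hi =>
      ((hfloor i (Finset.mem_Icc.1 hi).2).sub (hfloor (i - 1)
        ((Nat.sub_le _ _).trans (Finset.mem_Icc.1 hi).2))).mul_const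
          (|∑ j ∈ Finset.Icc i d, θ j| ^ α)).const_mul ((1 - u) ^ (-α))).congr fun n => ?_
    rw [tsum_abs_stepCoeff_rpow d θ _ hα (by simp [hτ0]) (hM n), hc, mul_left_comm]
    congr 1
    rw [Finset.mul_sum]
    exact Finset.sum_congr rfl fun i _ => by ring
  obtain ⟨C, hC⟩ := exists_abs_tsum_sub_tsum_le d θ hu hu1 hα
  have herr : Tendsto (fun n : ℕ => (n : ℝ)⁻¹ *
      ∑' s, |aggCoeff d θ (fun j => ⌊(n : ℝ) * τ j⌋₊) u s| ^ α - (n : ℝ)⁻¹ *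
      ∑' s, |(1 - u)⁻¹ * stepCoeff d θ (fun j => ⌊(n : ℝ) * τ j⌋₊) s| ^ α) atTop (nhds 0) := by
    have h0 : Tendsto (fun n : ℕ => (n : ℝ)⁻¹ * C) atTop (nhds 0) := by
      simpa using (tendsto_inv_atTop_nhds_zero_nat (𝕜 := ℝ)).mul_const C
    refine squeeze_zero_norm (fun n => ?_) h0
    rw [← mul_sub, Real.norm_eq_abs, abs_mul, abs_of_nonneg (by positivity)]
    gcongr
    exact hC _ fun j hj => hM n (Finset.mem_Icc.1 hj).2 (Set.mem_Iic.2 le_rfl)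
      (Finset.mem_Icc.1 hj).2
  simpa using herr.add hstep

theorem exists_inv_mul_tsum_abs_aggCoeff_rpow_le (d : ℕ) (θ τ : ℕ → ℝ)
    (hτ : ∀ j ≤ d, 0 ≤ τ j) {α : ℝ} (hα : 0 < α) :
    ∃ C, ∀ (n : ℕ) (u : ℝ), 0 ≤ u → u < 1 →
      (n : ℝ)⁻¹ * ∑' s, |aggCoeff d θ (fun j => ⌊(n : ℝ) * τ j⌋₊) u s| ^ α ≤
        C * (1 - u) ^ (-max α 1) := by
  have hγ : 0 < min α 1 := lt_min hα one_pos
  refine ⟨(2 * ∑ j ∈ Finset.Icc 1 d, |θ j|) ^ (α - min α 1) * (min α 1)⁻¹ *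
    ∑ j ∈ Finset.Icc 1 d, |θ j| ^ min α 1 * τ j, fun n u hu hu1 => ?_⟩
  have h1u : 0 < 1 - u := sub_pos.2 hu1
  have hsum : (n : ℝ)⁻¹ * ∑ j ∈ Finset.Icc 1 d, |θ j| ^ min α 1 * (⌊(n : ℝ) * τ j⌋₊ : ℝ) ≤
      ∑ j ∈ Finset.Icc 1 d, |θ j| ^ min α 1 * τ j := by
    rw [Finset.mul_sum]
    refine Finset.sum_le_sum fun j hj => ?_
    have hj' := hτ j (Finset.mem_Icc.1 hj).2
    rw [mul_left_comm]
    gcongr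
    rcases n.eq_zero_or_pos with rfl | hn
    · simpa using hj'
    · rw [inv_mul_le_iff₀ (by positivity)]
      exact Nat.floor_le (by positivity)
  calc _ ≤ (n : ℝ)⁻¹ * ((2 * ∑ j ∈ Finset.Icc 1 d, |θ j|) ^ (α - min α 1) * (min α 1)⁻¹ *
        (∑ j ∈ Finset.Icc 1 d, |θ j| ^ min α 1 * (⌊(n : ℝ) * τ j⌋₊ : ℝ)) *
          (1 - u) ^ (-max α 1)) := by
        gcongr
        exact tsum_abs_aggCoeff_rpow_le d θ _ hu hu1 hα
    _ = (2 * ∑ j ∈ Finset.Icc 1 d, |θ j|) ^ (α - min α 1) * (min α 1)⁻¹ *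
        ((n : ℝ)⁻¹ * ∑ j ∈ Finset.Icc 1 d, |θ j| ^ min α 1 * (⌊(n : ℝ) * τ j⌋₊ : ℝ)) *
          (1 - u) ^ (-max α 1) := by ring
    _ ≤ _ := by gcongr

theorem measurable_aggCoeff (d : ℕ) (θ : ℕ → ℝ) (M : ℕ → ℕ) (s : ℤ) :
    Measurable fun u => aggCoeff d θ M u s := by
  refine Finset.measurable_fun_sum _ fun j _ => Measurable.const_mul
    (Finset.measurable_fun_sum _ fun t _ => ?_) _
  unfold arCoeff
  split_ifs <;> fun_prop

theorem aemeasurable_tsum_abs_aggCoeff_rpow (d : ℕ) (θ : ℕ → ℝ) (M : ℕ → ℕ) {α : ℝ}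
    (hα : 0 < α) :
    AEMeasurable (fun u => ∑' s, |aggCoeff d θ M u s| ^ α) (volume.restrict (Set.Ico 0 1)) := by
  refine aemeasurable_of_tendsto_metrizable_ae (u := atTop)
    (f := fun (S : Finset ℤ) u => ∑ s ∈ S, |aggCoeff d θ M u s| ^ α) (fun S => ?_) ?_
  · refine (Finset.measurable_fun_sum _ fun s _ => ?_).aemeasurable
    have := measurable_aggCoeff d θ M s
    fun_prop
  · filter_upwards [ae_restrict_mem measurableSet_Ico] with u hu
    exact (summable_abs_aggCoeff_rpow d θ M hu.1 hu.2 hα).hasSum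

theorem integrableOn_one_sub_rpow {r : ℝ} (hr : -1 < r) :
    IntegrableOn (fun u : ℝ => (1 - u) ^ r) (Set.Ico 0 1) := by
  have h := (intervalIntegral.intervalIntegrable_rpow' (a := 0) (b := 1) hr).comp_sub_left 1
  rw [sub_zero, sub_self] at h
  exact ((intervalIntegrable_iff_integrableOn_Ico_of_le zero_le_one).1 h.symm)

theorem integrableOn_one_sub_rpow_mul {ψ : ℝ → ℝ} {ψ₁ β p : ℝ} (hp : 0 ≤ p) (hpβ : p < β)
    (hψnn : ∀ u ∈ Set.Ico (0 : ℝ) 1, 0 ≤ ψ u)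
    (hψlim : Tendsto ψ (nhdsWithin 1 (Set.Iio 1)) (nhds ψ₁))
    (hφint : IntegrableOn (fun u => ψ u * (1 - u) ^ (β - 1)) (Set.Ico 0 1)) :
    IntegrableOn (fun u => (1 - u) ^ (-p) * (ψ u * (1 - u) ^ (β - 1))) (Set.Ico 0 1) := by
  obtain ⟨c, hc1, hc⟩ : ∃ c < 1, ∀ u ∈ Set.Ioo c 1, ψ u < ψ₁ + 1 :=
    (mem_nhdsLT_iff_exists_Ioo_subset (a := (1 : ℝ))).1
      (hψlim.eventually (gt_mem_nhds (lt_add_one ψ₁)))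
  refine Integrable.mono' ((hφint.const_mul ((1 - c) ^ (-p))).add
    ((integrableOn_one_sub_rpow (r := β - 1 - p) (by linarith)).const_mul |ψ₁ + 1|)) ?_ ?_
  · refine AEStronglyMeasurable.mul ?_ hφint.aestronglyMeasurable
    exact (by fun_prop : Measurable fun u : ℝ => (1 - u) ^ (-p)).aestronglyMeasurable
  · filter_upwards [ae_restrict_mem measurableSet_Ico] with u hu
    have h1u : 0 < 1 - u := sub_pos.2 hu.2
    have hψ := hψnn u hu
    have h1c : 0 < 1 - c := sub_pos.2 hc1
    rw [Real.norm_of_nonneg (by positivity)]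
    simp only [Pi.add_apply]
    rcases le_or_gt u c with h | h
    · have : (1 - u) ^ (-p) ≤ (1 - c) ^ (-p) :=
        Real.rpow_le_rpow_of_nonpos h1c (by linarith) (by linarith)
      exact le_add_of_le_of_nonneg (by gcongr) (by positivity)
    · refine le_add_of_nonneg_of_le (by positivity) ?_
      rw [mul_left_comm, ← Real.rpow_add h1u, neg_add_eq_sub]
      gcongr
      exact (hc u ⟨h, hu.2⟩).le.trans (le_abs_self _)

theorem exp_neg_sub_one_le {x : ℝ} (hx : 0 ≤ x) : Real.exp (-x) - 1 ≤ -(x / (1 + x)) := by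
  have h : Real.exp (-x) ≤ (1 + x)⁻¹ := by
    rw [Real.exp_neg]
    exact inv_anti₀ (by positivity) (by linarith [Real.add_one_le_exp x])
  have : (1 + x)⁻¹ - 1 = -(x / (1 + x)) := by field_simp; ring
  linarith

theorem abs_mul_exp_neg_sub_one_le (N : ℕ) {x : ℝ} (hx : 0 ≤ x) :
    |(N : ℝ) * (Real.exp (-((N : ℝ)⁻¹ * x)) - 1)| ≤ x := by
  rcases N.eq_zero_or_pos with rfl | hN
  · simpa using hx
  have hN' : (0 : ℝ) < N := by positivity
  have h1 : Real.exp (-((N : ℝ)⁻¹ * x)) ≤ 1 := Real.exp_le_one_iff.2 (by simp; positivity)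
  have h2 := Real.add_one_le_exp (-((N : ℝ)⁻¹ * x))
  rw [abs_of_nonpos (mul_nonpos_of_nonneg_of_nonpos hN'.le (by linarith)), ← mul_neg,
    ← le_inv_mul_iff₀ hN']
  linarith

theorem tendsto_mul_exp_neg_sub_one {N : ℕ → ℕ} {x : ℕ → ℝ} {a : ℝ} (hN : Tendsto N atTop atTop)
    (hx : ∀ k, 0 ≤ x k) (hxa : Tendsto x atTop (nhds a)) :
    Tendsto (fun k => (N k : ℝ) * (Real.exp (-((N k : ℝ)⁻¹ * x k)) - 1)) atTop (nhds (-a)) := by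
  have hinv : Tendsto (fun k => (N k : ℝ)⁻¹ * x k) atTop (nhds 0) := by
    simpa using ((tendsto_inv_atTop_nhds_zero_nat (𝕜 := ℝ)).comp hN).mul hxa
  have hup : Tendsto (fun k => -(x k / (1 + (N k : ℝ)⁻¹ * x k))) atTop (nhds (-a)) := by
    simpa using (hxa.div (hinv.const_add 1) (by simp)).neg
  refine tendsto_of_tendsto_of_tendsto_of_le_of_le' hxa.neg hup
    (Eventually.of_forall fun k => (abs_le.1 (abs_mul_exp_neg_sub_one_le (N k) (hx k))).1) ?_
  filter_upwards [hN.eventually_gt_atTop 0] with k hk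
  have hk' : (0 : ℝ) < N k := by exact_mod_cast hk
  have hxk := hx k
  refine (mul_le_mul_of_nonneg_left (exp_neg_sub_one_le (by positivity)) hk'.le).trans_eq ?_
  field_simp

/-- the analytic core of Theorem 2.2(iii) in the simplified symmetric
setting (`h ≡ 1`, `ω ≡ 1`): with `K_n(u) := n^{−1} Σ_{s∈ℤ} |ϑ_n(u,s)|^α` and
`φ(u) = ψ(u)(1−u)^{β−1}` a probability density on `[0,1)` with `β > max(α,1)`,
one has `κ_α = ∫_0^1 (1−u)^{−α}φ(u)du < ∞` and
`N ∫_0^1 (exp(−N^{−1}K_n(u)) − 1)φ(u)du → −κ_α Σ_{i=1}^d (τ_i−τ_{i−1})|Σ_{j=i}^d θ_j|^α`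
as `N, n → ∞` in arbitrary way. -/
theorem stmt_16 (α β : ℝ) (hα0 : 0 < α) (hα2 : α ≤ 2) (hβ : max α 1 < β)
    (ψ : ℝ → ℝ) (ψ₁ : ℝ) (hψ₁ : 0 < ψ₁)
    (hψint : MeasureTheory.IntegrableOn ψ (Set.Ico 0 1))
    (hψnn : ∀ u ∈ Set.Ico (0:ℝ) 1, 0 ≤ ψ u)
    (hψlim : Filter.Tendsto ψ (nhdsWithin 1 (Set.Iio 1)) (nhds ψ₁))
    (hφint : MeasureTheory.IntegrableOn (fun u => ψ u * (1 - u) ^ (β - 1)) (Set.Ico 0 1))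
    (hφ1 : (∫ u in Set.Ico (0:ℝ) 1, ψ u * (1 - u) ^ (β - 1)) = 1)
    (d : ℕ) (hd : 0 < d) (θ τ : ℕ → ℝ) (hτ0 : τ 0 = 0)
    (hτmono : ∀ i, i < d → τ i < τ (i + 1)) :
    MeasureTheory.IntegrableOn
      (fun u => (1 - u) ^ (-α) * (ψ u * (1 - u) ^ (β - 1))) (Set.Ico 0 1) ∧
    ∀ Nseq nseq : ℕ → ℕ,
      Filter.Tendsto Nseq Filter.atTop Filter.atTop →
      Filter.Tendsto nseq Filter.atTop Filter.atTop →
      Filter.Tendsto (fun k =>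
          (Nseq k : ℝ) * ∫ u in Set.Ico (0:ℝ) 1,
            (Real.exp (-((Nseq k : ℝ)⁻¹ * ((nseq k : ℝ)⁻¹ *
              ∑' s : ℤ, |vth d θ τ (nseq k) u s| ^ α))) - 1) * (ψ u * (1 - u) ^ (β - 1)))
        Filter.atTop
        (nhds (-(∫ u in Set.Ico (0:ℝ) 1, (1 - u) ^ (-α) * (ψ u * (1 - u) ^ (β - 1))) *
          ∑ i ∈ Finset.Icc 1 d, (τ i - τ (i - 1)) * |∑ j ∈ Finset.Icc i d, θ j| ^ α)) := by
  have hα1 : α < β := (le_max_left _ _).trans_lt hβ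
  refine ⟨integrableOn_one_sub_rpow_mul hα0.le hα1 hψnn hψlim hφint, fun Nseq nseq hN hn => ?_⟩
  have hτ : MonotoneOn τ (Set.Iic d) :=
    monotoneOn_of_le_succ Set.ordConnected_Iic fun i _ _ hi => (hτmono i (Set.mem_Iic.1 hi)).le
  have hτnn : ∀ j ≤ d, 0 ≤ τ j := fun j hj =>
    hτ0 ▸ hτ (Set.mem_Iic.2 d.zero_le) (Set.mem_Iic.2 hj) j.zero_le
  have hvth : ∀ n u s, vth d θ τ n u s = aggCoeff d θ (fun j => ⌊(n : ℝ) * τ j⌋₊) u s :=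
    fun _ _ _ => rfl
  simp only [hvth]
  obtain ⟨C, hC⟩ := exists_inv_mul_tsum_abs_aggCoeff_rpow_le d θ τ hτnn hα0
  have hKnn : ∀ (n : ℕ) (u : ℝ), 0 ≤ (n : ℝ)⁻¹ *
      ∑' s, |aggCoeff d θ (fun j => ⌊(n : ℝ) * τ j⌋₊) u s| ^ α := fun n u =>
    mul_nonneg (by positivity) (tsum_nonneg fun _ => by positivity)
  simp only [← integral_const_mul]
  rw [← integral_neg, ← integral_mul_const]
  refine tendsto_integral_of_dominated_convergence
    (fun u => C * ((1 - u) ^ (-max α 1) * (ψ u * (1 - u) ^ (β - 1)))) (fun k => ?_)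
    ((integrableOn_one_sub_rpow_mul (by positivity) hβ hψnn hψlim hφint).const_mul C)
    (fun k => ?_) ?_
  · refine (AEStronglyMeasurable.mul ?_ hφint.aestronglyMeasurable).const_mul _
    have := aemeasurable_tsum_abs_aggCoeff_rpow d θ (fun j => ⌊(nseq k : ℝ) * τ j⌋₊) hα0
    exact (((this.const_mul _).const_mul _).neg.exp.sub_const 1).aestronglyMeasurable
  · filter_upwards [ae_restrict_mem measurableSet_Ico] with u hu
    have hφ : 0 ≤ ψ u * (1 - u) ^ (β - 1) :=
      mul_nonneg (hψnn u hu) (Real.rpow_nonneg (sub_pos.2 hu.2).le _)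
    generalize ψ u * (1 - u) ^ (β - 1) = φ at hφ ⊢
    rw [← mul_assoc (Nseq k : ℝ), ← mul_assoc C, norm_mul, Real.norm_of_nonneg hφ,
      Real.norm_eq_abs]
    refine mul_le_mul_of_nonneg_right ?_ hφ
    exact (abs_mul_exp_neg_sub_one_le _ (hKnn _ u)).trans (hC _ u hu.1 hu.2)
  · filter_upwards [ae_restrict_mem measurableSet_Ico] with u hu
    have h := (tendsto_mul_exp_neg_sub_one hN (fun k => hKnn (nseq k) u)
      ((tendsto_inv_mul_tsum_abs_aggCoeff_rpow d θ τ hτ0 hτ hα0 hu.1 hu.2).comp hn)).mul_const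
        (ψ u * (1 - u) ^ (β - 1))
    convert h using 2
    · exact (mul_assoc _ _ _).symm
    · ring
end

section
/- Let 0 < α ≤ 2, u ∈ [0,1), d ∈ ℕ, θ₁, …, θ_d ∈ ℝ and 0 = τ₀ < τ₁ < … < τ_d. Then lim_{n→∞} n^{−1} Σ_{s > 0} |ϑ_n(u,s)|^α = (1−u)^{−α} Σ_{i=1}^d (τ_i − τ_{i−1}) |Σ_{j=i}^d θ_j|^α. -/
open MeasureTheory Filter Set

/-- A Cesàro limit along a triangular array whose `m`-th entry is within `C * u ^ m` of `A`. -/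
lemma tendsto_inv_mul_sum_of_abs_sub_le_geometric {f : ℝ → ℝ} (hf : Continuous f)
    {u C A c : ℝ} (hu0 : 0 ≤ u) (hu1 : u < 1) (hC : 0 ≤ C) {x : ℕ → ℕ → ℝ} {M : ℕ → ℕ}
    (hx : ∀ n, ∀ m < M n, |x n m - A| ≤ C * u ^ m)
    (hM : Tendsto (fun n : ℕ => (n : ℝ)⁻¹ * M n) atTop (nhds c)) :
    Tendsto (fun n : ℕ => (n : ℝ)⁻¹ * ∑ m ∈ Finset.range (M n), f (x n m))
      atTop (nhds (c * f A)) := by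
  obtain ⟨K, hK⟩ := (isCompact_closedBall A C).exists_bound_of_continuousOn
    (f := fun y => f y - f A) (by fun_prop)
  have hK0 : 0 ≤ K := (norm_nonneg _).trans (hK A (Metric.mem_closedBall_self hC))
  have hbound : ∀ n, ∀ m < M n, |f (x n m) - f A| ≤ K := fun n m hm => by
    refine hK _ ?_
    rw [Metric.mem_closedBall, Real.dist_eq]
    exact (hx n m hm).trans (mul_le_of_le_one_right hC (pow_le_one₀ hu0 hu1.le))
  have hgeom : Tendsto (fun m : ℕ => C * u ^ m) atTop (nhds 0) := by
    simpa using (tendsto_pow_atTop_nhds_zero_of_lt_one hu0 hu1).const_mul C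
  have herr : Tendsto (fun n : ℕ => (n : ℝ)⁻¹ * ∑ m ∈ Finset.range (M n), (f (x n m) - f A))
      atTop (nhds 0) := by
    rw [Metric.tendsto_atTop']
    intro ε hε
    have hc0 : 0 ≤ c := ge_of_tendsto' hM fun n => by positivity
    set η := ε / (2 * (c + 1)) with hη
    have hη0 : 0 < η := by positivity
    obtain ⟨δ, hδ, hfδ⟩ := Metric.continuous_iff.1 hf A η hη0
    obtain ⟨m₀, hm₀⟩ := eventually_atTop.1 (hgeom.eventually_lt_const hδ)
    have hnear : ∀ n, ∀ m < M n, |f (x n m) - f A| ≤ η + if m < m₀ then K else 0 := by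
      intro n m hm
      split_ifs with h
      · linarith [hbound n m hm]
      · have := hfδ (x n m) (by
          rw [Real.dist_eq]
          exact (hx n m hm).trans_lt (hm₀ m (not_lt.1 h)))
        rw [Real.dist_eq] at this
        linarith
    have hsum : ∀ n, |∑ m ∈ Finset.range (M n), (f (x n m) - f A)| ≤ M n * η + m₀ * K := by
      intro n
      calc |∑ m ∈ Finset.range (M n), (f (x n m) - f A)|
          ≤ ∑ m ∈ Finset.range (M n), |f (x n m) - f A| := Finset.abs_sum_le_sum_abs _ _
        _ ≤ ∑ m ∈ Finset.range (M n), (η + if m < m₀ then K else 0) :=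
            Finset.sum_le_sum fun m hm => hnear n m (Finset.mem_range.1 hm)
        _ ≤ M n * η + m₀ * K := by
            rw [Finset.sum_add_distrib, ← Finset.sum_filter]
            simp only [Finset.sum_const, Finset.card_range, nsmul_eq_mul]
            gcongr
            calc _ ≤ (Finset.range m₀).card :=
                  Finset.card_le_card fun m hm => by simp_all
              _ = m₀ := Finset.card_range m₀
    have hlim : Tendsto (fun n : ℕ => ((n : ℝ)⁻¹ * M n) * η + (n : ℝ)⁻¹ * (m₀ * K)) atTop
        (nhds (c * η + 0 * (m₀ * K))) :=
      (hM.mul_const η).add (tendsto_inv_atTop_nhds_zero_nat.mul_const _)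
    have hlt : c * η + 0 * (m₀ * K) < ε := by
      rw [hη, zero_mul, add_zero, mul_div_assoc', div_lt_iff₀ (by positivity)]
      nlinarith
    obtain ⟨n₀, hn₀⟩ := eventually_atTop.1 (hlim.eventually_lt_const hlt)
    refine ⟨n₀, fun n hn => ?_⟩
    rw [Real.dist_eq, sub_zero, abs_mul, abs_of_nonneg (by positivity : (0 : ℝ) ≤ (n : ℝ)⁻¹)]
    calc (n : ℝ)⁻¹ * |∑ m ∈ Finset.range (M n), (f (x n m) - f A)|
        ≤ (n : ℝ)⁻¹ * (M n * η + m₀ * K) := by gcongr; exact hsum n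
      _ = ((n : ℝ)⁻¹ * M n) * η + (n : ℝ)⁻¹ * (m₀ * K) := by ring
      _ < ε := hn₀ n hn.le
  have := herr.add (hM.mul_const (f A))
  rw [zero_add] at this
  refine this.congr fun n => ?_
  rw [Finset.sum_sub_distrib, Finset.sum_const, Finset.card_range, nsmul_eq_mul]
  ring

lemma sum_Icc_ite_pow_eq {u : ℝ} (hu : u ≠ 1) (k N : ℕ) :
    (∑ t ∈ Finset.Icc 1 N,
      if ((k + 1 : ℕ) : ℤ) ≤ (t : ℤ) then u ^ ((t : ℤ) - ((k + 1 : ℕ) : ℤ)).toNat else 0)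
      = (1 - u ^ (N - k)) / (1 - u) := by
  have hu' : 1 - u ≠ 0 := sub_ne_zero.2 hu.symm
  induction N with
  | zero => simp
  | succ N ih =>
    rw [Finset.sum_Icc_succ_top (by omega), ih]
    split_ifs with h
    · have h1 : (((N + 1 : ℕ) : ℤ) - ((k + 1 : ℕ) : ℤ)).toNat = N - k := by omega
      have h2 : N + 1 - k = (N - k) + 1 := by omega
      rw [h1, h2, pow_succ]
      field_simp
      ring
    · have h1 : N - k = 0 := by omega
      have h2 : N + 1 - k = 0 := by omega
      rw [h1, h2, add_zero]

lemma vth_natCast_succ {u : ℝ} (hu : u ≠ 1) (d : ℕ) (θ τ : ℕ → ℝ) (n k : ℕ) :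
    vth d θ τ n u ((k + 1 : ℕ) : ℤ) =
      ∑ j ∈ Finset.Icc 1 d, θ j * ((1 - u ^ (⌊(n : ℝ) * τ j⌋₊ - k)) / (1 - u)) := by
  simp only [vth, sum_Icc_ite_pow_eq hu]

/-- If `g` vanishes beyond `N`, then its sum over the positive integers is a finite sum. -/
lemma tsum_int_pos_eq_sum_range {g : ℤ → ℝ} {N : ℕ} (hg : ∀ k : ℕ, N ≤ k → g ((k + 1 : ℕ) : ℤ) = 0) :
    (∑' s : ℤ, if 0 < s then g s else 0) = ∑ k ∈ Finset.range N, g ((k + 1 : ℕ) : ℤ) := by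
  have hinj : Function.Injective fun k : ℕ => ((k + 1 : ℕ) : ℤ) := fun a b h => by
    simpa using h
  rw [← hinj.tsum_eq (f := fun s : ℤ => if 0 < s then g s else 0),
    tsum_eq_sum (s := Finset.range N)]
  · exact Finset.sum_congr rfl fun k _ => if_pos (by positivity)
  · intro k hk
    rw [if_pos (by positivity)]
    exact hg k (by simpa using hk)
  · intro s hs
    have hs0 : 0 < s := by
      by_contra h
      exact hs (if_neg h)
    exact ⟨(s - 1).toNat, by dsimp only; omega⟩

/-- Split a sum over `range (N d)` into the blocks `[N i, N (i + 1))`, each read backwards. -/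
lemma sum_range_eq_sum_blocks {N : ℕ → ℕ} (h0 : N 0 = 0) (g : ℕ → ℝ) (d : ℕ)
    (hN : ∀ i < d, N i ≤ N (i + 1)) :
    ∑ k ∈ Finset.range (N d), g k =
      ∑ i ∈ Finset.range d, ∑ m ∈ Finset.range (N (i + 1) - N i), g (N (i + 1) - 1 - m) := by
  induction d with
  | zero => simp [h0]
  | succ d ih =>
    rw [Finset.sum_range_succ, ← ih fun i hi => hN i (by omega),
      ← Finset.sum_range_add_sum_Ico g (hN d (by omega))]
    congr 1
    rw [Finset.sum_Ico_eq_sum_range, ← Finset.sum_range_reflect]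
    refine Finset.sum_congr rfl fun m hm => ?_
    have := Finset.mem_range.1 hm
    congr 1
    omega

/-- the pointwise limit (4.25) used in the proof of Theorem 2.2(iii):
`lim_{n→∞} n^{−1} Σ_{s>0} |ϑ_n(u,s)|^α = (1−u)^{−α} Σ_{i=1}^d (τ_i−τ_{i−1})|Σ_{j=i}^d θ_j|^α`. -/
theorem stmt_17 (α : ℝ) (hα0 : 0 < α) (hα2 : α ≤ 2) (u : ℝ) (hu0 : 0 ≤ u) (hu1 : u < 1)
    (d : ℕ) (hd : 0 < d) (θ τ : ℕ → ℝ) (hτ0 : τ 0 = 0)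
    (hτmono : ∀ i, i < d → τ i < τ (i + 1)) :
    Filter.Tendsto (fun n : ℕ =>
        (n : ℝ)⁻¹ * ∑' s : ℤ, if 0 < s then |vth d θ τ n u s| ^ α else 0)
      Filter.atTop
      (nhds ((1 - u) ^ (-α) *
        ∑ i ∈ Finset.Icc 1 d, (τ i - τ (i - 1)) * |∑ j ∈ Finset.Icc i d, θ j| ^ α)) := by
  have hu : u ≠ 1 := hu1.ne
  have h1u : 0 < 1 - u := sub_pos.2 hu1
  have hτle : ∀ j ≤ d, ∀ i ≤ j, τ i ≤ τ j := by
    intro j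
    induction j with
    | zero => intro _ i hi; rw [Nat.le_zero.1 hi]
    | succ j ih =>
      intro hj i hi
      rcases Nat.le_succ_iff.1 hi with h | rfl
      · exact (ih (by omega) i h).trans (hτmono j hj).le
      · exact le_rfl
  set N : ℕ → ℕ → ℕ := fun n j => ⌊(n : ℝ) * τ j⌋₊ with hN
  have hNle : ∀ n, ∀ j ≤ d, ∀ i ≤ j, N n i ≤ N n j := fun n j hj i hi =>
    Nat.floor_mono (mul_le_mul_of_nonneg_left (hτle j hj i hi) n.cast_nonneg)
  have hNlim : ∀ j ≤ d, Tendsto (fun n : ℕ => (n : ℝ)⁻¹ * N n j) atTop (nhds (τ j)) := by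
    intro j hj
    have h := (tendsto_nat_floor_mul_div_atTop (hτ0 ▸ hτle j hj 0 j.zero_le)).comp
      tendsto_natCast_atTop_atTop
    refine h.congr fun n => ?_
    simp only [Function.comp, hN]
    rw [mul_comm (τ j), div_eq_inv_mul]
  have hv : ∀ n, ∀ i < d, ∀ m < N n (i + 1) - N n i,
      vth d θ τ n u ((N n (i + 1) - 1 - m + 1 : ℕ) : ℤ) =
        ∑ j ∈ Finset.Icc (i + 1) d,
          θ j * ((1 - u ^ (N n j - (N n (i + 1) - 1 - m))) / (1 - u)) := by
    intro n i hi m hm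
    rw [vth_natCast_succ hu]
    refine (Finset.sum_subset (Finset.Icc_subset_Icc_left (by omega)) fun j hj hj' => ?_).symm
    simp only [Finset.mem_Icc] at hj hj'
    have hji := hNle n i hi.le j (by omega)
    have : ⌊(n : ℝ) * τ j⌋₊ - (N n (i + 1) - 1 - m) = 0 := by
      change N n j - _ = 0
      omega
    simp [this]
  have hblock : ∀ i < d, Tendsto (fun n : ℕ => (n : ℝ)⁻¹ *
      ∑ m ∈ Finset.range (N n (i + 1) - N n i),
        |vth d θ τ n u ((N n (i + 1) - 1 - m + 1 : ℕ) : ℤ)| ^ α) atTop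
      (nhds ((τ (i + 1) - τ i) * |(∑ j ∈ Finset.Icc (i + 1) d, θ j) / (1 - u)| ^ α)) := by
    intro i hi
    refine tendsto_inv_mul_sum_of_abs_sub_le_geometric (f := fun y => |y| ^ α)
      (C := (∑ j ∈ Finset.Icc (i + 1) d, |θ j|) / (1 - u))
      (continuous_abs.rpow_const fun _ => Or.inr hα0.le) hu0 hu1
      (by positivity) ?_ ?_
    · intro n m hm
      rw [hv n i hi m hm, Finset.sum_div, ← Finset.sum_sub_distrib, Finset.sum_div,
        Finset.sum_mul]
      refine (Finset.abs_sum_le_sum_abs _ _).trans (Finset.sum_le_sum fun j hj => ?_)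
      have hj := Finset.mem_Icc.1 hj
      have hNj := hNle n j hj.2 (i + 1) hj.1
      have hrw : θ j * ((1 - u ^ (N n j - (N n (i + 1) - 1 - m))) / (1 - u)) - θ j / (1 - u)
          = -(θ j / (1 - u) * u ^ (N n j - (N n (i + 1) - 1 - m))) := by ring
      rw [hrw, abs_neg, abs_mul, abs_div, abs_of_pos h1u, abs_of_nonneg (pow_nonneg hu0 _)]
      exact mul_le_mul_of_nonneg_left (pow_le_pow_of_le_one hu0 hu1.le (by omega))
        (by positivity)
    · refine ((hNlim (i + 1) hi).sub (hNlim i hi.le)).congr fun n => ?_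
      rw [Nat.cast_sub (hNle n (i + 1) hi i (by omega))]
      ring
  have hsum := tendsto_finsetSum (Finset.range d) fun i hi => hblock i (Finset.mem_range.1 hi)
  have hlim : (1 - u) ^ (-α) *
        ∑ i ∈ Finset.Icc 1 d, (τ i - τ (i - 1)) * |∑ j ∈ Finset.Icc i d, θ j| ^ α =
      ∑ i ∈ Finset.range d,
        (τ (i + 1) - τ i) * |(∑ j ∈ Finset.Icc (i + 1) d, θ j) / (1 - u)| ^ α := by
    have hshift := Finset.sum_Ico_add' (fun i => (τ i - τ (i - 1)) *
      |(∑ j ∈ Finset.Icc i d, θ j) / (1 - u)| ^ α) 0 d 1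
    simp only [Nat.add_sub_cancel] at hshift
    rw [Finset.mul_sum, Finset.range_eq_Ico, hshift]
    refine Finset.sum_congr (by ext; simp) fun i _ => ?_
    rw [abs_div, abs_of_pos h1u, Real.div_rpow (abs_nonneg _) h1u.le, Real.rpow_neg h1u.le]
    ring
  rw [hlim]
  refine hsum.congr fun n => ?_
  rw [← Finset.mul_sum, tsum_int_pos_eq_sum_range (N := N n d)
      (g := fun s => |vth d θ τ n u s| ^ α),
    sum_range_eq_sum_blocks (N := N n) (by simp [hN, hτ0]) _ d
      fun i hi => hNle n (i + 1) hi i (by omega)]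
  intro k hk
  rw [vth_natCast_succ hu, Finset.sum_eq_zero, abs_zero, Real.zero_rpow hα0.ne']
  intro j hj
  have hjd := hNle n d le_rfl j (Finset.mem_Icc.1 hj).2
  have : ⌊(n : ℝ) * τ j⌋₊ - k = 0 := by
    change N n j - k = 0
    omega
  simp [this]
end

section
/- Let 0 < β < α ≤ 2, μ ∈ (0,∞), d ∈ ℕ, θ₁, …, θ_d ∈ ℝ and 0 < τ₁ < … < τ_d. For x > 0 define K_μ(x) := μ ∫_ℝ |Σ_{j=1}^d θ_j f_{τ_j/μ}(x,s)|^α ds; then ∫_0^∞ |e^{−K_μ(x)} − 1| x^{β−1} dx < ∞. Moreover, for any sequences N_k → ∞, n_k → ∞ of positive integers with N_k^{1/β}/n_k → μ, setting for 0 < x ≤ N_k^{1/β} and s ∈ ℝ: θ̃_k(x,s) := N_k^{−1/β} ϑ_{n_k}(1 − x N_k^{−1/β}, ⌊N_k^{1/β} s⌋) and K_k(x) := (N_k^{1/β}/n_k) ∫_ℝ |θ̃_k(x,s)|^α ds, one has lim_{k→∞} ∫_0^{N_k^{1/β}} (e^{−K_k(x)} − 1) x^{β−1} dx = ∫_0^∞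 (e^{−K_μ(x)} − 1) x^{β−1} dx. -/
open MeasureTheory Filter Set

/-- Closed form of `fker T x s` for `x > 0`. -/
noncomputable def kerForm (T x s : ℝ) : ℝ :=
  Real.exp (-x * max (-s) 0) * (1 - Real.exp (-x * max (T - max s 0) 0)) / x

theorem fker_eq_kerForm {T x s : ℝ} (hx : 0 < x) : fker T x s = kerForm T x s := by
  unfold fker kerForm
  have hder : ∀ t : ℝ, HasDerivAt (fun t => -Real.exp (-x * (t - s)) / x)
      (Real.exp (-x * (t - s))) t := by
    intro t
    have h1 : HasDerivAt (fun t : ℝ => -x * (t - s)) (-x * 1) t :=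
      ((hasDerivAt_id t).sub_const s).const_mul (-x)
    have h2 := (h1.exp.neg).div_const x
    refine h2.congr_deriv ?_
    field_simp
  have hint : ∀ a b : ℝ, ∫ t in a..b, Real.exp (-x * (t - s)) =
      -Real.exp (-x * (b - s)) / x - -Real.exp (-x * (a - s)) / x := fun a b =>
    intervalIntegral.integral_eq_sub_of_hasDerivAt (fun t _ => hder t)
      (Continuous.intervalIntegrable (by fun_prop) _ _)
  have hset : ∫ t in Ioc (0:ℝ) T, (if s ≤ t then Real.exp (-x * (t - s)) else 0) =
      ∫ t in Ioc (max s 0) T, Real.exp (-x * (t - s)) := by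
    have h1 : (fun t => if s ≤ t then Real.exp (-x * (t - s)) else 0) =
        (Ici s).indicator (fun t => Real.exp (-x * (t - s))) := by
      ext t; simp [indicator]
    rw [h1, setIntegral_indicator measurableSet_Ici]
    apply setIntegral_congr_set
    have h2 : Ioc (max s 0) T = Ioc 0 T ∩ Ioi s := by
      ext t; simp only [mem_Ioc, mem_inter_iff, mem_Ioi, max_lt_iff]; tauto
    rw [h2]
    exact (ae_eq_refl _).inter Ioi_ae_eq_Ici.symm
  rw [hset]
  rcases le_total (max s 0) T with h | h
  · rw [← intervalIntegral.integral_of_le h, hint, max_eq_left (sub_nonneg.2 h)]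
    have e1 : max s 0 - s = max (-s) 0 := by
      rcases le_total s 0 with h' | h' <;> simp [h']
    have e2 : Real.exp (-x * (T - s)) =
        Real.exp (-x * max (-s) 0) * Real.exp (-x * (T - max s 0)) := by
      rw [← Real.exp_add, ← e1]; ring_nf
    rw [e1, e2]; ring
  · rw [Ioc_eq_empty (not_lt.2 h), max_eq_right (sub_nonpos.2 h)]; simp

theorem sum_pow_shift_eq {u : ℝ} (hu : u ≠ 1) (M : ℕ) (p : ℤ) :
    ∑ t ∈ Finset.Icc 1 M, (if p ≤ (t : ℤ) then u ^ ((t : ℤ) - p).toNat else 0) =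
      u ^ (1 - p).toNat * (1 - u ^ ((M : ℤ) + 1 - max p 1).toNat) / (1 - u) := by
  have hu' : 1 - u ≠ 0 := sub_ne_zero.2 hu.symm
  induction M with
  | zero =>
    have : (((0 : ℕ) : ℤ) + 1 - max p 1).toNat = 0 := by omega
    rw [this]; simp
  | succ M ih =>
    rw [Finset.sum_Icc_succ_top (by omega), ih]
    split_ifs with h
    · have e1 : (((M + 1 : ℕ) : ℤ) - p).toNat =
          (1 - p).toNat + ((M : ℤ) + 1 - max p 1).toNat := by omega
      have e2 : (((M + 1 : ℕ) : ℤ) + 1 - max p 1).toNat =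
          ((M : ℤ) + 1 - max p 1).toNat + 1 := by omega
      rw [e1, e2, pow_add, pow_succ]
      field_simp
      ring
    · have e1 : ((M : ℤ) + 1 - max p 1).toNat = 0 := by omega
      have e2 : (((M + 1 : ℕ) : ℤ) + 1 - max p 1).toNat = 0 := by omega
      rw [e1, e2]; simp

/-- Rescaled geometric sum, the discrete counterpart of `kerForm`. -/
noncomputable def discForm (L : ℝ) (M : ℕ) (x s : ℝ) : ℝ :=
  (1 - x * L⁻¹) ^ (1 - ⌊L * s⌋).toNat *
    (1 - (1 - x * L⁻¹) ^ ((M : ℤ) + 1 - max ⌊L * s⌋ 1).toNat) / x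

theorem inv_mul_vth_eq {d : ℕ} {θ τ : ℕ → ℝ} {n : ℕ} {L x s : ℝ} (hL : 0 < L) (hx : 0 < x) :
    L⁻¹ * vth d θ τ n (1 - x * L⁻¹) ⌊L * s⌋ =
      ∑ j ∈ Finset.Icc 1 d, θ j * discForm L ⌊(n : ℝ) * τ j⌋₊ x s := by
  have hu : 1 - x * L⁻¹ ≠ 1 := by
    have : 0 < x * L⁻¹ := by positivity
    linarith
  unfold vth
  rw [Finset.mul_sum]
  refine Finset.sum_congr rfl fun j _ => ?_
  rw [sum_pow_shift_eq hu, discForm, sub_sub_cancel]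
  field_simp

theorem kerForm_mem {T T' x s : ℝ} (hx : 0 < x) (hT : T ≤ T') :
    (0 ≤ kerForm T x s ∧ kerForm T x s ≤ Real.exp (-x * max (-s) 0) / x) ∧
      (T' < s → kerForm T x s = 0) := by
  have h1 : Real.exp (-x * max (T - max s 0) 0) ≤ 1 := by
    rw [Real.exp_le_one_iff]
    have : 0 ≤ max (T - max s 0) 0 := le_max_right _ _
    nlinarith
  have h2 := Real.exp_pos (-x * max (T - max s 0) 0)
  unfold kerForm
  refine ⟨⟨?_, ?_⟩, fun h => ?_⟩
  · have : 0 ≤ 1 - Real.exp (-x * max (T - max s 0) 0) := by linarith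
    positivity
  · gcongr
    exact mul_le_of_le_one_right (Real.exp_pos _).le (by linarith)
  · have : max (T - max s 0) 0 = 0 := by
      rw [max_eq_right]
      have := le_max_left s 0
      linarith
    simp [this]

theorem one_sub_pow_le_exp {y : ℝ} (hy : y ≤ 1) (k : ℕ) : (1 - y) ^ k ≤ Real.exp (-y * k) := by
  rw [mul_comm, Real.exp_nat_mul]
  exact pow_le_pow_left₀ (by linarith) (Real.one_sub_le_exp_neg y) k

theorem discForm_mem {L T x s : ℝ} {M : ℕ} (hL : 0 < L) (hx : 0 < x) (hxL : x ≤ L)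
    (hT : M + 1 ≤ L * T) :
    (0 ≤ discForm L M x s ∧ discForm L M x s ≤ Real.exp (-x * max (-s) 0) / x) ∧
      (T < s → discForm L M x s = 0) := by
  have hy : x * L⁻¹ ≤ 1 := by rw [← div_eq_mul_inv]; exact (div_le_one hL).2 hxL
  have hy0 : 0 < x * L⁻¹ := by positivity
  set y := x * L⁻¹ with hydef
  have h0 : ∀ k : ℕ, 0 ≤ (1 - y) ^ k := fun k => pow_nonneg (by linarith) k
  have h1 : ∀ k : ℕ, (1 - y) ^ k ≤ 1 := fun k => pow_le_one₀ (by linarith) (by linarith)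
  unfold discForm
  rw [← hydef]
  refine ⟨⟨?_, ?_⟩, fun h => ?_⟩
  · have := h0 (1 - ⌊L * s⌋).toNat
    have := h1 ((M : ℤ) + 1 - max ⌊L * s⌋ 1).toNat
    have : 0 ≤ 1 - (1 - y) ^ ((M : ℤ) + 1 - max ⌊L * s⌋ 1).toNat := by linarith
    positivity
  · gcongr
    refine (mul_le_of_le_one_right (h0 _) (by linarith [h0 ((M : ℤ) + 1 - max ⌊L * s⌋ 1).toNat])).trans
      ((one_sub_pow_le_exp hy _).trans (Real.exp_le_exp.2 ?_))
    have hf := Int.floor_le (L * s)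
    have hk : L * max (-s) 0 ≤ ((1 - ⌊L * s⌋).toNat : ℝ) := by
      have hc : (1 : ℝ) - ⌊L * s⌋ ≤ ((1 - ⌊L * s⌋).toNat : ℝ) := by
        have := Int.self_le_toNat (1 - ⌊L * s⌋)
        exact_mod_cast this
      rcases le_total (-s) 0 with h | h
      · rw [max_eq_right h]; simp
      · rw [max_eq_left h]; linarith
    have : y * (L * max (-s) 0) = x * max (-s) 0 := by
      rw [hydef]; field_simp
    nlinarith
  · have hf : (M : ℤ) + 1 ≤ ⌊L * s⌋ := by
      rw [Int.le_floor]; push_cast; nlinarith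
    have : ((M : ℤ) + 1 - max ⌊L * s⌋ 1).toNat = 0 := by omega
    rw [this]; simp

theorem tendsto_one_sub_pow {L : ℕ → ℝ} (hL : Tendsto L atTop atTop) {k : ℕ → ℕ} {c : ℝ}
    (hk : Tendsto (fun i => (k i : ℝ) / L i) atTop (nhds c)) (x : ℝ) :
    Tendsto (fun i => (1 - x * (L i)⁻¹) ^ k i) atTop (nhds (Real.exp (-x * c))) := by
  have h1 := (Real.tendsto_mul_log_one_add_div_atTop (-x)).comp hL
  have h2 := (Real.continuous_exp.tendsto _).comp (h1.mul hk)
  refine h2.congr' ?_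
  filter_upwards [hL.eventually_gt_atTop 0, hL.eventually_gt_atTop x] with i hi hxi
  have : 0 < 1 - x * (L i)⁻¹ := by
    have := (div_lt_one hi).2 hxi
    rw [div_eq_mul_inv] at this
    linarith
  have e1 : 1 + -x / L i = 1 - x * (L i)⁻¹ := by ring
  have e2 : L i * Real.log (1 - x * (L i)⁻¹) * (k i / L i) =
      k i * Real.log (1 - x * (L i)⁻¹) := by field_simp
  simp only [Function.comp_apply]
  rw [e1, e2, Real.exp_nat_mul, Real.exp_log this]

theorem tendsto_toNat_div {L : ℕ → ℝ} {z : ℕ → ℤ} {c : ℝ}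
    (hL : Tendsto L atTop atTop)
    (hz : Tendsto (fun i => (z i : ℝ) / L i) atTop (nhds c)) :
    Tendsto (fun i => ((z i).toNat : ℝ) / L i) atTop (nhds (max c 0)) := by
  refine (hz.max tendsto_const_nhds).congr' ?_
  filter_upwards [hL.eventually_gt_atTop 0] with i hi
  have : (((z i).toNat : ℕ) : ℝ) = max (z i : ℝ) 0 := by
    have := Int.ofNat_toNat (z i)
    exact_mod_cast congrArg (Int.cast (R := ℝ)) this
  rw [this, ← max_div_div_right hi.le, zero_div]

theorem tendsto_floor_mul_div {L : ℕ → ℝ} (hL : Tendsto L atTop atTop) (s : ℝ) :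
    Tendsto (fun i => (⌊L i * s⌋ : ℝ) / L i) atTop (nhds s) := by
  have h1 : Tendsto (fun i => s - (L i)⁻¹) atTop (nhds s) := by
    simpa using (tendsto_const_nhds (x := s)).sub hL.inv_tendsto_atTop
  refine tendsto_of_tendsto_of_tendsto_of_le_of_le' h1 tendsto_const_nhds ?_ ?_
  · filter_upwards [hL.eventually_gt_atTop 0] with i hi
    rw [le_div_iff₀ hi, sub_mul, inv_mul_cancel₀ hi.ne']
    linarith [Int.lt_floor_add_one (L i * s)]
  · filter_upwards [hL.eventually_gt_atTop 0] with i hi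
    rw [div_le_iff₀ hi]
    linarith [Int.floor_le (L i * s)]

theorem tendsto_discForm {L : ℕ → ℝ} (hL : Tendsto L atTop atTop) {M : ℕ → ℕ} {T : ℝ}
    (hM : Tendsto (fun i => (M i : ℝ) / L i) atTop (nhds T)) (x s : ℝ) :
    Tendsto (fun i => discForm (L i) (M i) x s) atTop (nhds (kerForm T x s)) := by
  have hinv : Tendsto (fun i => 1 / L i) atTop (nhds 0) := by
    simpa [Pi.inv_def] using hL.inv_tendsto_atTop
  have hfl := tendsto_floor_mul_div hL s
  have h1 : Tendsto (fun i => ((1 - ⌊L i * s⌋ : ℤ) : ℝ) / L i) atTop (nhds (-s)) := by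
    have := hinv.sub hfl
    rw [zero_sub] at this
    refine this.congr fun i => ?_
    push_cast; ring
  have h2 : Tendsto (fun i => (((M i : ℤ) + 1 - max ⌊L i * s⌋ 1 : ℤ) : ℝ) / L i) atTop
      (nhds (T - max s 0)) := by
    have := (hM.add hinv).sub (hfl.max hinv)
    rw [add_zero] at this
    refine this.congr' ?_
    filter_upwards [hL.eventually_gt_atTop 0] with i hi
    rw [max_div_div_right hi.le]
    push_cast; ring
  have h3 := tendsto_one_sub_pow hL (tendsto_toNat_div hL h1) x
  have h4 := tendsto_one_sub_pow hL (tendsto_toNat_div hL h2) x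
  exact (h3.mul (tendsto_const_nhds.sub h4)).div_const x

/-- Envelope for the `α`-th power of the rescaled kernels. -/
noncomputable def envelope (α T x s : ℝ) : ℝ :=
  (Iic (0:ℝ)).indicator (fun s => Real.exp (α * x * s)) s + (Ioc 0 T).indicator (fun _ => 1) s

theorem integrable_envelope {α x : ℝ} (hα : 0 < α) (hx : 0 < x) (T : ℝ) :
    Integrable (envelope α T x) := by
  refine Integrable.add ?_ ?_
  · rw [integrable_indicator_iff measurableSet_Iic]
    exact integrableOn_exp_mul_Iic (mul_pos hα hx) 0
  · rw [integrable_indicator_iff measurableSet_Ioc]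
    exact integrableOn_const (by simp) (by simp)

theorem integral_envelope {α x T : ℝ} (hα : 0 < α) (hx : 0 < x) (hT : 0 ≤ T) :
    ∫ s, envelope α T x s = 1 / (α * x) + T := by
  unfold envelope
  rw [integral_add, integral_indicator measurableSet_Iic, integral_indicator measurableSet_Ioc,
    integral_exp_mul_Iic (mul_pos hα hx)]
  · simp [hT]
  · rw [integrable_indicator_iff measurableSet_Iic]
    exact integrableOn_exp_mul_Iic (mul_pos hα hx) 0
  · rw [integrable_indicator_iff measurableSet_Ioc]
    exact integrableOn_const (by simp) (by simp)

theorem abs_sum_rpow_le_envelope {α x s T : ℝ} (hα : 0 < α) (hx : 0 < x) (d : ℕ)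
    (θ E : ℕ → ℝ)
    (hE : ∀ j ∈ Finset.Icc 1 d, (0 ≤ E j ∧ E j ≤ Real.exp (-x * max (-s) 0) / x) ∧
      (T < s → E j = 0)) :
    |∑ j ∈ Finset.Icc 1 d, θ j * E j| ^ α ≤
      ((∑ j ∈ Finset.Icc 1 d, |θ j|) / x) ^ α * envelope α T x s := by
  set Θ := ∑ j ∈ Finset.Icc 1 d, |θ j| with hΘ
  have hΘ0 : 0 ≤ Θ := Finset.sum_nonneg fun j _ => abs_nonneg _
  have hb : |∑ j ∈ Finset.Icc 1 d, θ j * E j| ≤ Θ / x * Real.exp (-x * max (-s) 0) := by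
    refine (Finset.abs_sum_le_sum_abs _ _).trans ?_
    rw [hΘ, Finset.sum_div, Finset.sum_mul]
    refine Finset.sum_le_sum fun j hj => ?_
    rw [abs_mul, abs_of_nonneg (hE j hj).1.1]
    calc |θ j| * E j ≤ |θ j| * (Real.exp (-x * max (-s) 0) / x) := by
          gcongr; exact (hE j hj).1.2
      _ = _ := by ring
  have hbα := Real.rpow_le_rpow (abs_nonneg _) hb hα.le
  rw [Real.mul_rpow (by positivity) (Real.exp_pos _).le, ← Real.exp_mul] at hbα
  unfold envelope
  rcases le_or_gt s 0 with hs | hs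
  · refine hbα.trans ?_
    rw [indicator_of_mem (show s ∈ Iic 0 from hs),
      indicator_of_notMem (show s ∉ Ioc 0 T from fun h => absurd h.1 (not_lt.2 hs)),
      max_eq_left (by linarith), add_zero]
    apply le_of_eq; ring_nf
  · rw [indicator_of_notMem (show s ∉ Iic 0 from not_le.2 hs), zero_add]
    rcases le_or_gt s T with hT | hT
    · rw [indicator_of_mem (show s ∈ Ioc 0 T from ⟨hs, hT⟩)]
      rw [max_eq_right (by linarith)] at hbα
      simpa using hbα
    · rw [indicator_of_notMem (show s ∉ Ioc 0 T from fun h => absurd h.2 (not_le.2 hT)),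
        Finset.sum_eq_zero fun j hj => by rw [(hE j hj).2 hT, mul_zero]]
      simp [Real.zero_rpow hα.ne']

/-- Dominating function for the outer integral. -/
noncomputable def outerBound (α β C x : ℝ) : ℝ :=
  (Ioc (0:ℝ) 1).indicator (fun x => x ^ (β - 1)) x +
    (Ioi (1:ℝ)).indicator (fun x => C * x ^ (β - 1 - α)) x

theorem integrable_outerBound {α β : ℝ} (hβ : 0 < β) (hβα : β < α) (C : ℝ) :
    Integrable (outerBound α β C) := by
  refine Integrable.add ?_ ?_
  · rw [integrable_indicator_iff measurableSet_Ioc,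
      ← intervalIntegrable_iff_integrableOn_Ioc_of_le zero_le_one]
    exact intervalIntegral.intervalIntegrable_rpow' (by linarith)
  · rw [integrable_indicator_iff measurableSet_Ioi]
    exact (integrableOn_Ioi_rpow_of_lt (by linarith) one_pos).const_mul C

theorem outerBound_nonneg {α β C : ℝ} (hC : 0 ≤ C) (x : ℝ) : 0 ≤ outerBound α β C x := by
  unfold outerBound
  refine add_nonneg (indicator_nonneg (fun y hy => ?_) x) (indicator_nonneg (fun y hy => ?_) x)
  · exact Real.rpow_nonneg hy.1.le _
  · exact mul_nonneg hC (Real.rpow_nonneg (zero_le_one.trans (le_of_lt hy)) _)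

theorem abs_exp_sub_one_mul_le {α β m m' Θ T x : ℝ} {h : ℝ → ℝ} (hα : 0 < α) (hx : 0 < x)
    (hm : 0 ≤ m) (hmm : m ≤ m') (hΘ : 0 ≤ Θ) (hT : 0 ≤ T)
    (hh : ∀ s, |h s| ^ α ≤ (Θ / x) ^ α * envelope α T x s) :
    |Real.exp (-(m * ∫ s, |h s| ^ α)) - 1| * x ^ (β - 1) ≤
      outerBound α β (m' * Θ ^ α * (1 / α + T)) x := by
  have hK0 : 0 ≤ ∫ s, |h s| ^ α := integral_nonneg fun s => Real.rpow_nonneg (abs_nonneg _) _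
  have hK : ∫ s, |h s| ^ α ≤ (Θ / x) ^ α * (1 / (α * x) + T) := by
    rw [← integral_envelope hα hx hT, ← integral_const_mul]
    exact integral_mono_of_nonneg (ae_of_all _ fun s => Real.rpow_nonneg (abs_nonneg _) _)
      ((integrable_envelope hα hx T).const_mul _) (ae_of_all _ hh)
  set K := ∫ s, |h s| ^ α
  have hmK : 0 ≤ m * K := mul_nonneg hm hK0
  have he : |Real.exp (-(m * K)) - 1| = 1 - Real.exp (-(m * K)) := by
    rw [abs_sub_comm, abs_of_nonneg]
    have := Real.exp_le_one_iff.2 (neg_nonpos.2 hmK)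
    linarith
  have hxp : 0 < x ^ (β - 1) := Real.rpow_pos_of_pos hx _
  rw [he]
  unfold outerBound
  rcases le_or_gt x 1 with h1 | h1
  · rw [indicator_of_mem (show x ∈ Ioc 0 1 from ⟨hx, h1⟩),
      indicator_of_notMem (show x ∉ Ioi 1 from not_lt.2 h1), add_zero]
    exact mul_le_of_le_one_left hxp.le (by linarith [Real.exp_pos (-(m * K))])
  · rw [indicator_of_notMem (show x ∉ Ioc 0 1 from fun h => absurd h.2 (not_le.2 h1)),
      indicator_of_mem (show x ∈ Ioi 1 from h1), zero_add]
    have h2 : 1 - Real.exp (-(m * K)) ≤ m * K := by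
      linarith [Real.one_sub_le_exp_neg (m * K)]
    have h3 : 1 / (α * x) ≤ 1 / α := by
      apply one_div_le_one_div_of_le hα
      nlinarith
    have h4 : x ^ (β - 1 - α) = x ^ (β - 1) * (x ^ α)⁻¹ := by
      rw [Real.rpow_sub hx (β - 1) α, div_eq_mul_inv]
    calc (1 - Real.exp (-(m * K))) * x ^ (β - 1)
        ≤ (m' * ((Θ / x) ^ α * (1 / α + T))) * x ^ (β - 1) := by
          gcongr
          refine h2.trans ?_
          have hm' : 0 ≤ m' := hm.trans hmm
          have hp : 0 ≤ (Θ / x) ^ α := by positivity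
          refine mul_le_mul hmm (hK.trans ?_) hK0 hm'
          gcongr
      _ = _ := by
          rw [h4, Real.div_rpow hΘ hx.le]; ring

theorem stronglyMeasurable_exponent {α m : ℝ} {h : ℝ → ℝ → ℝ}
    (hh : Measurable (Function.uncurry h)) (β : ℝ) :
    StronglyMeasurable
      (fun x => (Real.exp (-(m * ∫ s, |h x s| ^ α)) - 1) * x ^ (β - 1)) := by
  have h1 : Measurable (Function.uncurry fun x s => |h x s| ^ α) :=
    (measurable_norm.comp hh).pow_const α
  have h2 : Measurable fun x => ∫ s, |h x s| ^ α :=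
    (h1.stronglyMeasurable.integral_prod_right).measurable
  exact (((h2.const_mul m).neg.exp.sub_const 1).mul (measurable_id.pow_const _)).stronglyMeasurable

theorem tendsto_exponent_integral {α β μ Θ T : ℝ} (hβ : 0 < β) (hβα : β < α)
    (hΘ : 0 ≤ Θ) (hT : 0 ≤ T) {L m : ℕ → ℝ} {h : ℕ → ℝ → ℝ → ℝ} {h₀ : ℝ → ℝ → ℝ}
    (hL : Tendsto L atTop atTop) (hm : Tendsto m atTop (nhds μ)) (hm0 : ∀ k, 0 ≤ m k)
    (hmeas : ∀ k, Measurable (Function.uncurry (h k)))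
    (hbound : ∀ᶠ k in atTop, ∀ x ∈ Ioc 0 (L k), ∀ s,
      |h k x s| ^ α ≤ (Θ / x) ^ α * envelope α T x s)
    (hlim : ∀ x > 0, ∀ s, Tendsto (fun k => h k x s) atTop (nhds (h₀ x s))) :
    Tendsto (fun k => ∫ x in Ioc 0 (L k),
        (Real.exp (-(m k * ∫ s, |h k x s| ^ α)) - 1) * x ^ (β - 1)) atTop
      (nhds (∫ x in Ioi 0, (Real.exp (-(μ * ∫ s, |h₀ x s| ^ α)) - 1) * x ^ (β - 1))) := by
  have hα : 0 < α := hβ.trans hβα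
  have hrw : ∀ k, ∫ x in Ioc 0 (L k),
        (Real.exp (-(m k * ∫ s, |h k x s| ^ α)) - 1) * x ^ (β - 1) =
      ∫ x in Ioi 0, (Ioc 0 (L k)).indicator (fun x =>
        (Real.exp (-(m k * ∫ s, |h k x s| ^ α)) - 1) * x ^ (β - 1)) x := by
    intro k
    rw [setIntegral_indicator measurableSet_Ioc, inter_eq_right.2 fun x hx => hx.1]
  simp_rw [hrw]
  have hC : 0 ≤ (|μ| + 1) * Θ ^ α * (1 / α + T) := by positivity
  refine tendsto_integral_filter_of_dominated_convergence
    (outerBound α β ((|μ| + 1) * Θ ^ α * (1 / α + T))) ?_ ?_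
    (integrable_outerBound hβ hβα _).integrableOn ?_
  · exact Eventually.of_forall fun k =>
      ((stronglyMeasurable_exponent (hmeas k) β).indicator measurableSet_Ioc).aestronglyMeasurable
  · have hmev : ∀ᶠ k in atTop, m k ≤ |μ| + 1 :=
      hm.eventually_le_const (by linarith [le_abs_self μ])
    filter_upwards [hbound, hmev] with k hk hmk
    filter_upwards with x
    by_cases hx : x ∈ Ioc 0 (L k)
    · rw [indicator_of_mem hx, Real.norm_eq_abs, abs_mul, abs_of_nonneg (a := x ^ (β - 1))
        (Real.rpow_nonneg hx.1.le _)]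
      exact abs_exp_sub_one_mul_le hα hx.1 (hm0 k) hmk hΘ hT (hk x hx)
    · rw [indicator_of_notMem hx, norm_zero]
      exact outerBound_nonneg hC x
  · filter_upwards [ae_restrict_mem measurableSet_Ioi] with x hx
    have hx0 : 0 < x := hx
    have hinner : Tendsto (fun k => ∫ s, |h k x s| ^ α) atTop (nhds (∫ s, |h₀ x s| ^ α)) := by
      refine tendsto_integral_filter_of_dominated_convergence
        (fun s => (Θ / x) ^ α * envelope α T x s) ?_ ?_
        ((integrable_envelope hα hx0 T).const_mul _) ?_
      · refine Eventually.of_forall fun k => Measurable.aestronglyMeasurable ?_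
        have : Measurable (h k x) := (hmeas k).comp measurable_prodMk_left
        exact (measurable_norm.comp this).pow_const α
      · filter_upwards [hbound, hL.eventually_ge_atTop x] with k hk hxk
        filter_upwards with s
        rw [Real.norm_eq_abs, abs_of_nonneg (Real.rpow_nonneg (abs_nonneg _) _)]
        exact hk x ⟨hx0, hxk⟩ s
      · filter_upwards with s
        exact (hlim x hx0 s).abs.rpow_const (Or.inr hα.le)
    have hF := (((Real.continuous_exp.tendsto _).comp (hm.mul hinner).neg).sub_const 1).mul_const
      (x ^ (β - 1))
    refine hF.congr' ?_
    filter_upwards [hL.eventually_ge_atTop x] with k hk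
    rw [indicator_of_mem (show x ∈ Ioc 0 (L k) from ⟨hx0, hk⟩)]
    rfl

theorem measurable_kerForm (T : ℝ) : Measurable (Function.uncurry (kerForm T)) := by
  unfold kerForm Function.uncurry
  fun_prop

theorem measurable_vth (d : ℕ) (θ τ : ℕ → ℝ) (n : ℕ) (c L : ℝ) :
    Measurable (Function.uncurry fun x s : ℝ => c * vth d θ τ n (1 - x * c) ⌊L * s⌋) := by
  have h1 : Measurable (fun p : ℝ × ℤ => vth d θ τ n p.1 p.2) := by
    refine measurable_from_prod_countable_left fun z => Continuous.measurable ?_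
    unfold vth
    refine continuous_finsetSum _ fun j _ => continuous_const.mul
      (continuous_finsetSum _ fun t _ => ?_)
    dsimp only
    split_ifs <;> fun_prop
  have h2 : Measurable (fun p : ℝ × ℝ => (1 - p.1 * c, ⌊L * p.2⌋)) := by fun_prop
  exact (h1.comp h2).const_mul c

theorem pos_of_step_lt {d : ℕ} {τ : ℕ → ℝ} (hτ1 : 0 < τ 1)
    (hτmono : ∀ i, 1 ≤ i → i < d → τ i < τ (i + 1)) {j : ℕ} (hj : j ∈ Finset.Icc 1 d) :
    0 < τ j := by
  obtain ⟨h1, h2⟩ := Finset.mem_Icc.1 hj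
  clear hj
  induction j, h1 using Nat.le_induction with
  | base => exact hτ1
  | succ i hi ih => exact (ih (by omega)).trans (hτmono i hi (by omega))

/-- the analytic core of the intermediate-regime convergence (2.21) of
Theorem 2.2(i) in the simplified symmetric setting (`h ≡ 1`, `ω ≡ 1`,
`φ(u) = (1−u)^{β−1}` with `ψ₁ = 1`): with
`K_μ(x) := μ ∫_ℝ |Σ_{j=1}^d θ_j f_{τ_j/μ}(x,s)|^α ds`, the function
`(e^{−K_μ(x)} − 1)x^{β−1}` is integrable on `(0,∞)`, and for `N_k, n_k → ∞` with
`N_k^{1/β}/n_k → μ`, the characteristic exponents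
`∫_0^{N_k^{1/β}} (e^{−K_k(x)} − 1)x^{β−1}dx` (with
`K_k(x) = (N_k^{1/β}/n_k)∫_ℝ |N_k^{−1/β}ϑ_{n_k}(1−xN_k^{−1/β},⌊N_k^{1/β}s⌋)|^α ds`)
converge to `∫_0^∞ (e^{−K_μ(x)} − 1)x^{β−1}dx`. -/
theorem stmt_19 (α β μ : ℝ) (hβ0 : 0 < β) (hβα : β < α) (hα2 : α ≤ 2) (hμ : 0 < μ)
    (d : ℕ) (hd : 0 < d) (θ τ : ℕ → ℝ)
    (hτ1 : 0 < τ 1) (hτmono : ∀ i, 1 ≤ i → i < d → τ i < τ (i + 1)) :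
    MeasureTheory.IntegrableOn
      (fun x : ℝ =>
        |Real.exp (-(μ * ∫ s : ℝ,
            |∑ j ∈ Finset.Icc 1 d, θ j * fker (τ j / μ) x s| ^ α)) - 1| * x ^ (β - 1))
      (Set.Ioi 0) ∧
    ∀ Nseq nseq : ℕ → ℕ,
      Filter.Tendsto Nseq Filter.atTop Filter.atTop →
      Filter.Tendsto nseq Filter.atTop Filter.atTop →
      Filter.Tendsto (fun k => ((Nseq k : ℝ) ^ ((1:ℝ) / β)) / (nseq k : ℝ))
        Filter.atTop (nhds μ) →
      Filter.Tendsto (fun k =>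
          ∫ x in Set.Ioc (0:ℝ) ((Nseq k : ℝ) ^ ((1:ℝ) / β)),
            (Real.exp (-(((Nseq k : ℝ) ^ ((1:ℝ) / β) / (nseq k : ℝ)) *
              ∫ s : ℝ,
                |(Nseq k : ℝ) ^ (-((1:ℝ) / β)) *
                  vth d θ τ (nseq k) (1 - x * (Nseq k : ℝ) ^ (-((1:ℝ) / β)))
                    ⌊(Nseq k : ℝ) ^ ((1:ℝ) / β) * s⌋| ^ α)) - 1) * x ^ (β - 1))
        Filter.atTop
        (nhds (∫ x in Set.Ioi (0:ℝ),
          (Real.exp (-(μ * ∫ s : ℝ,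
              |∑ j ∈ Finset.Icc 1 d, θ j * fker (τ j / μ) x s| ^ α)) - 1)
            * x ^ (β - 1))) := by
  have hα : 0 < α := hβ0.trans hβα
  have hτ : ∀ j ∈ Finset.Icc 1 d, 0 < τ j := fun j hj => pos_of_step_lt hτ1 hτmono hj
  set Θ := ∑ j ∈ Finset.Icc 1 d, |θ j|
  have hΘ : 0 ≤ Θ := Finset.sum_nonneg fun j _ => abs_nonneg _
  set T := ∑ j ∈ Finset.Icc 1 d, τ j / μ + 1
  have hT0 : 0 ≤ T := add_nonneg (Finset.sum_nonneg fun j hj => (div_pos (hτ j hj) hμ).le)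
    zero_le_one
  have hτT : ∀ j ∈ Finset.Icc 1 d, τ j / μ < T := fun j hj => by
    have := Finset.single_le_sum (f := fun j => τ j / μ)
      (fun i hi => (div_pos (hτ i hi) hμ).le) hj
    linarith
  set h₀ : ℝ → ℝ → ℝ := fun x s => ∑ j ∈ Finset.Icc 1 d, θ j * kerForm (τ j / μ) x s
  have hmeas₀ : Measurable (Function.uncurry h₀) :=
    Finset.measurable_fun_sum _ fun j _ => (measurable_kerForm (τ j / μ)).const_mul (θ j)
  have heq : ∀ x > 0, ∀ s, ∑ j ∈ Finset.Icc 1 d, θ j * fker (τ j / μ) x s = h₀ x s :=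
    fun x hx s => Finset.sum_congr rfl fun j _ => by rw [fker_eq_kerForm hx]
  have hbound₀ : ∀ x > 0, ∀ s, |h₀ x s| ^ α ≤ (Θ / x) ^ α * envelope α T x s :=
    fun x hx s => abs_sum_rpow_le_envelope hα hx d θ _ fun j hj => kerForm_mem hx (hτT j hj).le
  constructor
  · have hI : IntegrableOn (fun x => |Real.exp (-(μ * ∫ s, |h₀ x s| ^ α)) - 1| * x ^ (β - 1))
        (Ioi 0) := by
      refine Integrable.mono'
        (integrable_outerBound hβ0 hβα (μ * Θ ^ α * (1 / α + T))).integrableOn ?_ ?_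
      · refine (stronglyMeasurable_exponent (m := μ) (α := α) hmeas₀ β).aestronglyMeasurable.norm.congr ?_
        filter_upwards [ae_restrict_mem measurableSet_Ioi] with x hx
        rw [Real.norm_eq_abs, abs_mul, abs_of_nonneg (Real.rpow_nonneg (le_of_lt hx) (β - 1))]
      · filter_upwards [ae_restrict_mem measurableSet_Ioi] with x hx
        rw [Real.norm_eq_abs, abs_of_nonneg
          (mul_nonneg (abs_nonneg _) (Real.rpow_nonneg (le_of_lt hx) _))]
        exact abs_exp_sub_one_mul_le hα hx hμ.le le_rfl hΘ hT0 (hbound₀ x hx)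
    refine hI.congr_fun (fun x hx => ?_) measurableSet_Ioi
    simp only [heq x hx]
  · intro N n hN hn hNn
    have hL : Tendsto (fun k => (N k : ℝ) ^ ((1:ℝ) / β)) atTop atTop :=
      (tendsto_rpow_atTop (one_div_pos.2 hβ0)).comp (tendsto_natCast_atTop_atTop.comp hN)
    have hneg : ∀ k, (N k : ℝ) ^ (-((1:ℝ) / β)) = ((N k : ℝ) ^ ((1:ℝ) / β))⁻¹ :=
      fun k => Real.rpow_neg (Nat.cast_nonneg _) _
    have hLnn : ∀ k, 0 ≤ (N k : ℝ) ^ ((1:ℝ) / β) := fun k => Real.rpow_nonneg (Nat.cast_nonneg _) _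
    simp_rw [hneg]
    set L : ℕ → ℝ := fun k => (N k : ℝ) ^ ((1:ℝ) / β)
    have hn' : Tendsto (fun k => (n k : ℝ)) atTop atTop := tendsto_natCast_atTop_atTop.comp hn
    have hnL : Tendsto (fun k => (n k : ℝ) / L k) atTop (nhds μ⁻¹) :=
      (hNn.inv₀ hμ.ne').congr fun k => inv_div _ _
    have hM : ∀ j ∈ Finset.Icc 1 d,
        Tendsto (fun k => (⌊(n k : ℝ) * τ j⌋₊ : ℝ) / L k) atTop (nhds (τ j / μ)) := by
      intro j hj
      have h1 := ((tendsto_nat_floor_mul_div_atTop (hτ j hj).le).comp hn').mul hnL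
      rw [← div_eq_mul_inv] at h1
      refine h1.congr' ?_
      filter_upwards [hn'.eventually_gt_atTop 0] with k hk
      simp only [Function.comp_apply]
      rw [mul_comm (τ j)]
      field_simp
    have hMT : ∀ᶠ k in atTop, ∀ j ∈ Finset.Icc 1 d, (⌊(n k : ℝ) * τ j⌋₊ : ℝ) + 1 ≤ L k * T := by
      rw [Filter.eventually_all_finset]
      intro j hj
      have h1 := (hM j hj).add hL.inv_tendsto_atTop
      rw [add_zero] at h1
      filter_upwards [h1.eventually_lt_const (hτT j hj), hL.eventually_gt_atTop 0] with k hk hLk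
      have h2 : ((⌊(n k : ℝ) * τ j⌋₊ : ℝ) + 1) / L k < T := by
        simpa [add_div] using hk
      rw [div_lt_iff₀ hLk] at h2
      linarith
    have hmain := tendsto_exponent_integral (h₀ := h₀) (α := α)
      (h := fun k x s => (L k)⁻¹ * vth d θ τ (n k) (1 - x * (L k)⁻¹) ⌊L k * s⌋)
      hβ0 hβα hΘ hT0 hL hNn (fun k => div_nonneg (hLnn k) (Nat.cast_nonneg _))
      (fun k => measurable_vth d θ τ (n k) (L k)⁻¹ (L k)) ?_ ?_
    · have hR : ∫ x in Ioi (0:ℝ), (Real.exp (-(μ * ∫ s : ℝ,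
              |∑ j ∈ Finset.Icc 1 d, θ j * fker (τ j / μ) x s| ^ α)) - 1) * x ^ (β - 1) =
          ∫ x in Ioi (0:ℝ), (Real.exp (-(μ * ∫ s : ℝ, |h₀ x s| ^ α)) - 1) * x ^ (β - 1) :=
        setIntegral_congr_fun measurableSet_Ioi fun x hx => by simp only [heq x hx]
      rw [hR]
      exact hmain
    · filter_upwards [hMT, hL.eventually_gt_atTop 0] with k hk hLk x hx s
      rw [inv_mul_vth_eq hLk hx.1]
      exact abs_sum_rpow_le_envelope hα hx.1 d θ _ fun j hj =>
        discForm_mem hLk hx.1 hx.2 (hk j hj)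
    · intro x hx s
      refine (tendsto_finsetSum _ fun j hj =>
        (tendsto_discForm hL (hM j hj) x s).const_mul (θ j)).congr' ?_
      filter_upwards [hL.eventually_gt_atTop 0] with k hLk
      rw [inv_mul_vth_eq hLk hx]
end
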